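/- For n ∈ {9, 10}: every 𝒫₄-free 3-graph H on n vertices that is isomorphic to a sub-3-graph of neither the starplus Sₙ^{+1} nor SPₙ satisfies |H| ≤ 4n − 10, and equality holds if and only if H is isomorphic to SKₙ. -/

import Mathlib

open Finset

/-- `H` is a 3-graph on the vertex set `V`: every edge is a 3-element subset of `V`. -/
def ThreeGraphOn (V : Finset ℕ) (H : Finset (Finset ℕ)) : Prop :=
  ∀ e ∈ H, e ⊆ V ∧ e.card = 3

/-- Four edges form a 3-uniform minimal 4-path: `aᵢ ∩ aⱼ ≠ ∅ ↔ |i - j| ≤ 1`. -/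
def IsMinPath4 (a₀ a₁ a₂ a₃ : Finset ℕ) : Prop :=
  (a₀ ∩ a₁).Nonempty ∧ (a₁ ∩ a₂).Nonempty ∧ (a₂ ∩ a₃).Nonempty ∧
    a₀ ∩ a₂ = ∅ ∧ a₀ ∩ a₃ = ∅ ∧ a₁ ∩ a₃ = ∅

/-- `H` contains no minimal 4-path. -/
def P4Free (H : Finset (Finset ℕ)) : Prop :=
  ¬∃ a₀ ∈ H, ∃ a₁ ∈ H, ∃ a₂ ∈ H, ∃ a₃ ∈ H, IsMinPath4 a₀ a₁ a₂ a₃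

/-- `H` is a starplus on `V`: a full star with center `v` together with one
extra 3-edge not containing `v`. -/
def IsStarPlusOn (V : Finset ℕ) (H : Finset (Finset ℕ)) : Prop :=
  ∃ v ∈ V, ∃ e : Finset ℕ, e ⊆ V ∧ e.card = 3 ∧ v ∉ e ∧
    H = (V.powersetCard 3).filter (fun t => v ∈ t) ∪ {e}

/-- `H` is (isomorphic to) a sub-3-graph of the starplus on `V`. -/
def SubStarPlus (V : Finset ℕ) (H : Finset (Finset ℕ)) : Prop :=
  ∃ H' : Finset (Finset ℕ), IsStarPlusOn V H' ∧ H ⊆ H'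

/-- `H` is the `P`-star `SPₙ` on `V`: a minimal 2-path `f₁, f₂` (two 3-edges
sharing exactly one vertex) together with all triples of `V` containing a
vertex `v` outside the path and at least one vertex of the path. -/
def IsSPOn (V : Finset ℕ) (H : Finset (Finset ℕ)) : Prop :=
  ∃ v ∈ V, ∃ f₁ f₂ : Finset ℕ, f₁ ⊆ V ∧ f₂ ⊆ V ∧ f₁.card = 3 ∧ f₂.card = 3 ∧
    (f₁ ∩ f₂).card = 1 ∧ v ∉ f₁ ∪ f₂ ∧
    H = {f₁, f₂} ∪
      (V.powersetCard 3).filter (fun t => v ∈ t ∧ (t ∩ (f₁ ∪ f₂)).Nonempty)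

/-- `H` is (isomorphic to) a sub-3-graph of `SPₙ` on `V`. -/
def SubSP (V : Finset ℕ) (H : Finset (Finset ℕ)) : Prop :=
  ∃ H' : Finset (Finset ℕ), IsSPOn V H' ∧ H ⊆ H'

/-- `H` is the `K`-star `SKₙ` on `V`: a complete 3-graph on a 4-set `A`
together with all triples of `V` containing a vertex `v ∉ A` and at least one
vertex of `A`. -/
def IsSKOn (V : Finset ℕ) (H : Finset (Finset ℕ)) : Prop :=
  ∃ v ∈ V, ∃ A : Finset ℕ, A ⊆ V ∧ A.card = 4 ∧ v ∉ A ∧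
    H = A.powersetCard 3 ∪
      (V.powersetCard 3).filter (fun t => v ∈ t ∧ (t ∩ A).Nonempty)


structure Ent where
  b : ℕ
  N : ℕ
  D : ℕ
  O : ℕ

def codes : List ℕ := [12, 13, 23, 123, 14, 24, 124, 34, 134, 234, 15, 25, 125, 35, 135, 235, 45, 145, 245, 345, 16, 26, 126, 36, 136, 236, 46, 146, 246, 346, 56, 156, 256, 356, 456, 17, 27, 127, 37, 137, 237, 47, 147, 247, 347, 57, 157, 257, 357, 457, 67, 167, 267, 367, 467, 567, 18, 28, 128, 38, 138, 238, 48, 148, 248, 348, 58, 158, 258, 358, 458, 68, 168, 268, 368, 468, 568, 78, 178, 278, 378, 478, 578, 678, 19, 29, 129, 39, 139, 239, 49, 149, 249, 349, 59, 159, 259, 359, 459, 69, 169, 269, 369, 469, 569, 79, 179, 279, 379, 479, 579, 679, 89, 189, 289, 389, 489, 589, 689, 789]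

noncomputable def stmOf (v : ℕ) (l : List ℕ) : ℕ :=
  List.rec (motive := fun _ => ℕ) 0
    (fun c _ ih => Nat.add (Nat.mul 128 ih)
      (cond (Nat.beq v (Nat.div c 100)) 1 (cond (Nat.beq v (Nat.mod (Nat.div c 10) 10)) 1
        (cond (Nat.beq v (Nat.mod c 10)) 1 0)))) l

noncomputable def stm (v : ℕ) : ℕ := stmOf v codes

def full (m : ℕ) : ℕ := Nat.div (Nat.sub (Nat.pow 128 m) 1) 127

noncomputable def codeAt (i : ℕ) : ℕ :=
  List.rec (motive := fun _ => ℕ → ℕ) (fun _ => 0)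
    (fun c _ ih k => cond (Nat.beq k 0) c (ih (Nat.sub k 1))) codes i

noncomputable def mkN (A B C : ℕ) : ℕ := Nat.lor A (Nat.lor B C)
noncomputable def mkO (A B C : ℕ) : ℕ := Nat.xor (Nat.xor A (Nat.xor B C)) (Nat.land A (Nat.land B C))

noncomputable def ent (i : ℕ) : Ent :=
  let c := codeAt i
  let A := stm (Nat.div c 100)
  let B := stm (Nat.mod (Nat.div c 10) 10)
  let C := stm (Nat.mod c 10)
  ⟨Nat.pow 128 i, mkN A B C, Nat.xor (full 120) (mkN A B C), mkO A B C⟩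

noncomputable def dis (x y : Ent) : Bool := Nat.beq (Nat.land x.N y.b) 0

noncomputable def kill3 (x y z : Ent) (xy : Bool) : ℕ :=
  cond xy
    (cond (dis x z)
      (cond (dis y z) 0 (Nat.land x.N (Nat.xor y.N z.N)))
      (cond (dis y z) (Nat.land y.N (Nat.xor x.N z.N)) (Nat.land z.D (Nat.xor x.N y.N))))
    (cond (dis x z)
      (cond (dis y z) (Nat.land z.N (Nat.xor x.N y.N)) (Nat.land y.D (Nat.xor x.N z.N)))
      (cond (dis y z) (Nat.land x.D (Nat.xor y.N z.N)) 0))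

noncomputable def killL (x y : Ent) (xy : Bool) (l : List Ent) (k : ℕ) : ℕ :=
  List.rec (motive := fun _ => ℕ → ℕ) (fun k => k)
    (fun z _ ih k => ih (Nat.lor k (kill3 x y z xy))) l k

noncomputable def killOf (k2 : Ent → Ent → ℕ) (x : Ent) (l : List Ent) (k : ℕ) : ℕ :=
  List.rec (motive := fun _ => ℕ → ℕ) (fun k => k)
    (fun y t ih k => ih (killL x y (dis x y) t (Nat.lor k (k2 x y)))) l k

noncomputable def dead (cs : List (ℕ × ℕ)) (av : ℕ) : Bool :=
  List.rec (motive := fun _ => Bool) false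
    (fun c _ ih => cond (Nat.ble c.2 (Nat.mod (Nat.land av c.1) 127)) ih true) cs

noncomputable def go (k2 : Ent → Ent → ℕ) (cs : List (ℕ × ℕ)) (ord : List ℕ) : List Ent → ℕ → ℕ → Bool :=
  List.rec (motive := fun _ => List Ent → ℕ → ℕ → Bool) (fun _ _ av => dead cs av)
    (fun i _ ih l inm av =>
      (fun x : Ent =>
        cond (Nat.beq (Nat.land av x.b) 0) (ih l inm av)
          ((fun K : ℕ =>
            (fun a : ℕ => cond
              (cond (Nat.beq (Nat.land K inm) 0) (cond (dead cs a) true (ih (x :: l) (Nat.lor inm x.b) a)) true)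
              ((fun a : ℕ => cond (dead cs a) true (ih l inm a)) (Nat.xor av x.b)) false)
            (Nat.xor av (Nat.land av K))) (killOf k2 x l 0)))
      (ent i)) ord

/-- add the roots -/
noncomputable def start (k2 : Ent → Ent → ℕ) (cs : List (ℕ × ℕ)) (ord : List ℕ) (roots : List ℕ) : List Ent → ℕ → ℕ → Bool :=
  List.rec (motive := fun _ => List Ent → ℕ → ℕ → Bool) (fun l inm av => cond (dead cs av) true (go k2 cs ord l inm av))
    (fun i _ ih l inm av =>
      (fun x : Ent => 
         (fun K : ℕ => ih (x :: l) (Nat.lor inm x.b) (Nat.xor av (Nat.land av K))) (killOf k2 x l 0))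
      (ent i)) roots

noncomputable def k2_0 (_ _ : Ent) : ℕ := 0
noncomputable def k2_1 (x y : Ent) : ℕ := cond (dis x y) (Nat.land x.D y.D) 0
noncomputable def one (x y : Ent) : Bool := Nat.beq (Nat.land x.O y.b) 0
noncomputable def k2_3 (x y : Ent) : ℕ := 
  cond (dis x y) (Nat.lor (Nat.land x.D (Nat.lor y.D y.O)) (Nat.land x.O y.D)) (cond (one x y) 0 (Nat.land x.D y.D))
noncomputable def k2_11 (x y : Ent) : ℕ := 
  cond (dis x y) (Nat.land (Nat.lor x.D x.O) (Nat.lor y.D y.O)) 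
   (cond (one x y) 0 (Nat.lor (Nat.land x.D (Nat.lor y.D y.O)) (Nat.land x.O y.D)))
noncomputable def k2_99 (x y : Ent) : ℕ := Nat.lor x.D y.D

noncomputable def avoid (m v : ℕ) : ℕ := Nat.land (full m) (Nat.xor (full 120) (stm v))
noncomputable def conds9 : List (ℕ × ℕ) := [(full 84, 26), (avoid 84 0, 5), (avoid 84 1, 5), (avoid 84 2, 5), (avoid 84 3, 5), (avoid 84 4, 5), (avoid 84 5, 5), (avoid 84 6, 5), (avoid 84 7, 5), (avoid 84 8, 5)]
noncomputable def conds10 : List (ℕ × ℕ) := [(full 120, 30), (avoid 120 0, 5), (avoid 120 1, 5), (avoid 120 2, 5), (avoid 120 3, 5), (avoid 120 4, 5), (avoid 120 5, 5), (avoid 120 6, 5), (avoid 120 7, 5), (avoid 120 8, 5), (avoid 120 9, 5)]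

noncomputable def E (i : ℕ) : Finset ℕ :=
  {codeAt i / 100, codeAt i / 10 % 10, codeAt i % 10}

noncomputable def tb (X j : ℕ) : Bool := X.testBit (7 * j)

theorem stm_tb : ∀ v < 10, ∀ j < 120, tb (stm v) j = decide (v ∈ E j) := by
  decide +kernel

theorem E_dig : ∀ i < 120, codeAt i / 100 < codeAt i / 10 % 10 ∧ codeAt i / 10 % 10 < codeAt i % 10 ∧ codeAt i % 10 < 10 := by
  decide +kernel

theorem E_lt9 : ∀ i < 84, codeAt i % 10 < 9 := by
  decide +kernel

theorem full_bits : ∀ p < 840, (full 120).testBit p = decide (p % 7 = 0) := by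
  decide +kernel

theorem full84_tb : ∀ j < 120, tb (full 84) j = decide (j < 84) := by
  decide +kernel

theorem E_surj : ∀ c < 10, ∀ b < c, ∀ a < b, ∃ i < 120, (c < 9 → i < 84) ∧ codeAt i = 100 * a + 10 * b + c := by
  have : ∀ c < 10, ∀ b < c, ∀ a < b, codeAt (a + b*(b-1)/2 + c*(c-1)*(c-2)/6) = 100 * a + 10 * b + c ∧ a + b*(b-1)/2 + c*(c-1)*(c-2)/6 < 120 ∧ (c < 9 → a + b*(b-1)/2 + c*(c-1)*(c-2)/6 < 84) := by
    decide +kernel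
  intro c hc b hb a ha
  exact ⟨_, (this c hc b hb a ha).2.1, (this c hc b hb a ha).2.2, (this c hc b hb a ha).1⟩

theorem code_inj : ∀ i < 120, ∀ j < 120, codeAt i = codeAt j → i = j := by
  have : ∀ i < 120, (fun k => codeAt k / 100 + (codeAt k / 10 % 10) * ((codeAt k / 10 % 10) - 1) / 2 + (codeAt k % 10) * (codeAt k % 10 - 1) * (codeAt k % 10 - 2) / 6) i = i := by
    decide +kernel
  intro i hi j hj h
  rw [← this i hi, ← this j hj]
  simp only [h]

theorem tb_land (a b j : ℕ) : tb (Nat.land a b) j = (tb a j && tb b j) := Nat.testBit_and ..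
theorem tb_lor (a b j : ℕ) : tb (Nat.lor a b) j = (tb a j || tb b j) := Nat.testBit_or ..
theorem tb_xor (a b j : ℕ) : tb (Nat.xor a b) j = (tb a j ^^ tb b j) := Nat.testBit_xor ..
theorem tb_pow (i j : ℕ) : tb (Nat.pow 128 i) j = decide (i = j) := by
  have : Nat.pow 128 i = 2 ^ (7 * i) := by
    show 128 ^ i = _
    rw [pow_mul]; norm_num
  rw [tb, this, Nat.testBit_two_pow]
  simp
theorem land_pow_beq (X i : ℕ) : Nat.beq (Nat.land X (Nat.pow 128 i)) 0 = !tb X i := by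
  have : Nat.pow 128 i = 2 ^ (7 * i) := by
    show 128 ^ i = _
    rw [pow_mul]; norm_num
  have h2 : Nat.land X (Nat.pow 128 i) = (X.testBit (7 * i)).toNat * 2 ^ (7 * i) := by
    rw [this]; exact Nat.and_two_pow ..
  rw [h2, tb]
  cases h : X.testBit (7 * i)
  · simp
  · have : 0 < 2 ^ (7 * i) := by positivity
    simp only [Bool.toNat_true, one_mul, Bool.not_true]
    rw [← Bool.not_eq_true, Nat.beq_eq]; omega

noncomputable def q (i j : ℕ) : Bool := decide (0 < (E i ∩ E j).card)
theorem q_comm (i j : ℕ) : q i j = q j i := by simp [q, inter_comm]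

theorem card_inter (i j : ℕ) (hi : i < 120) : (E i ∩ E j).card =
    (decide (codeAt i / 100 ∈ E j)).toNat + (decide (codeAt i / 10 % 10 ∈ E j)).toNat + (decide (codeAt i % 10 ∈ E j)).toNat := by
  obtain ⟨h1, h2, h3⟩ := E_dig i hi
  rw [E]
  generalize codeAt i / 100 = a at *
  generalize codeAt i / 10 % 10 = b at *
  generalize codeAt i % 10 = c at *
  have e : ({a, b, c} : Finset ℕ) ∩ E j = ({a, b, c} : Finset ℕ).filter (· ∈ E j) := by
    ext; simp
  rw [e, card_filter, sum_insert (by simp; omega), sum_insert (by simp; omega), sum_singleton]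
  by_cases ha : a ∈ E j <;> by_cases hb : b ∈ E j <;> by_cases hc : c ∈ E j <;> simp [ha, hb, hc]

theorem N_tb (i j : ℕ) (hi : i < 120) (hj : j < 120) : tb (ent i).N j = q i j := by
  obtain ⟨h1, h2, h3⟩ := E_dig i hi
  rw [q, card_inter i j hi]
  show tb (Nat.lor (stm (codeAt i / 100)) (Nat.lor (stm (codeAt i / 10 % 10)) (stm (codeAt i % 10)))) j = _
  rw [tb_lor, tb_lor, stm_tb _ (by omega) _ hj, stm_tb _ (by omega) _ hj, stm_tb _ (by omega) _ hj]
  generalize decide (codeAt i / 100 ∈ E j) = a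
  generalize decide (codeAt i / 10 % 10 ∈ E j) = b
  generalize decide (codeAt i % 10 ∈ E j) = c
  revert a b c; decide

theorem full_tb (j : ℕ) (hj : j < 120) : tb (full 120) j = true := by
  rw [tb, full_bits _ (by omega)]; simp

theorem D_tb (i j : ℕ) (hi : i < 120) (hj : j < 120) : tb (ent i).D j = !q i j := by
  rw [← N_tb i j hi hj]
  show tb (Nat.xor (full 120) (ent i).N) j = _
  rw [tb_xor, full_tb j hj]; simp

theorem O_tb (i j : ℕ) (hi : i < 120) (hj : j < 120) : tb (ent i).O j = decide ((E i ∩ E j).card = 1) := by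
  obtain ⟨h1, h2, h3⟩ := E_dig i hi
  rw [card_inter i j hi]
  show tb (Nat.xor (Nat.xor (stm (codeAt i / 100)) (Nat.xor (stm (codeAt i / 10 % 10)) (stm (codeAt i % 10)))) (Nat.land (stm (codeAt i / 100)) (Nat.land (stm (codeAt i / 10 % 10)) (stm (codeAt i % 10))))) j = _
  simp only [tb_xor, tb_land]
  rw [stm_tb _ (by omega) _ hj, stm_tb _ (by omega) _ hj, stm_tb _ (by omega) _ hj]
  generalize decide (codeAt i / 100 ∈ E j) = a
  generalize decide (codeAt i / 10 % 10 ∈ E j) = b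
  generalize decide (codeAt i % 10 ∈ E j) = c
  revert a b c; decide

theorem b_tb (i j : ℕ) : tb (ent i).b j = decide (i = j) := tb_pow i j

theorem dis_ent (i j : ℕ) (hi : i < 120) (hj : j < 120) : dis (ent i) (ent j) = !q i j := by
  rw [← N_tb i j hi hj]
  exact land_pow_beq _ _

theorem one_ent (i j : ℕ) (hi : i < 120) (hj : j < 120) : one (ent i) (ent j) = !decide ((E i ∩ E j).card = 1) := by
  rw [← O_tb i j hi hj]
  exact land_pow_beq _ _

/-- index version of being free -/
def FreeI (HI : Finset ℕ) : Prop := ∀ a ∈ HI, ∀ b ∈ HI, ∀ c ∈ HI, ∀ d ∈ HI,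
  (q a b && q b c && q c d && !q a c && !q a d && !q b d) = false

theorem kill3_bool : ∀ xy xz yz xw yw zw : Bool,
    (xy && yz && zw && !xz && !xw && !yw) = false →
    (zw && xz && xy && !yz && !yw && !xw) = false →
    (xz && yz && yw && !xy && !xw && !zw) = false →
    (xz && xy && yw && !yz && !zw && !xw) = false →
    (xy && xz && zw && !yz && !yw && !xw) = false →
    (xy && yz && xw && !xz && !zw && !yw) = false →
    (xz && yz && xw && !xy && !yw && !zw) = false →
    (xy && yw && zw && !xw && !xz && !yz) = false →
    (xy && xw && zw && !yw && !yz && !xz) = false →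
    (xz && zw && yw && !xw && !xy && !yz) = false →
    (xz && xw && yw && !zw && !yz && !xy) = false →
    (yz && yw && xw && !zw && !xz && !xy) = false →
    (yz && zw && xw && !yw && !xy && !xz) = false →
    cond (!xy)
    (cond (!xz)
      (cond (!yz) false (xw && (yw ^^ zw)))
      (cond (!yz) (yw && (xw ^^ zw)) (!zw && (xw ^^ yw))))
    (cond (!xz)
      (cond (!yz) (zw && (xw ^^ yw)) (!yw && (xw ^^ zw)))
      (cond (!yz) (!xw && (yw ^^ zw)) false)) = false := by decide

theorem tb_cond (b : Bool) (x y j : ℕ) : tb (cond b x y) j = cond b (tb x j) (tb y j) := by cases b <;> rfl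
theorem tb_zero (j : ℕ) : tb 0 j = false := by simp [tb]

theorem kill3_sound (HI : Finset ℕ) (hb : ∀ i ∈ HI, i < 120) (hf : FreeI HI) (x y z w : ℕ)
    (hx : x ∈ HI) (hy : y ∈ HI) (hz : z ∈ HI) (hw : w ∈ HI) :
    tb (kill3 (ent x) (ent y) (ent z) (dis (ent x) (ent y))) w = false := by
  have bx := hb x hx
  have by' := hb y hy
  have bz := hb z hz
  have bw := hb w hw
  simp only [kill3, tb_cond, tb_land, tb_xor, tb_zero, dis_ent, N_tb, D_tb, bx, by', bz, bw]
  apply kill3_bool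
  · have := hf x hx y hy z hz w hw; exact this
  · have := hf w hw z hz x hx y hy; rw [q_comm w z, q_comm z x, q_comm w x, q_comm w y, q_comm z y] at this; revert this; cases q z w <;> cases q x z <;> cases q x y <;> cases q x w <;> cases q y w <;> cases q y z <;> simp
  · have := hf x hx z hz y hy w hw; rw [q_comm z y] at this; revert this; cases q z w <;> cases q x z <;> cases q x y <;> cases q x w <;> cases q y w <;> cases q y z <;> simp
  · have := hf z hz x hx y hy w hw; rw [q_comm z y, q_comm z x] at this; revert this; cases q z w <;> cases q x z <;> cases q x y <;> cases q x w <;> cases q y w <;> cases q y z <;> simp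
  · have := hf y hy x hx z hz w hw; rw [q_comm y x] at this; revert this; cases q z w <;> cases q x z <;> cases q x y <;> cases q x w <;> cases q y w <;> cases q y z <;> simp
  · have := hf z hz y hy x hx w hw; rw [q_comm z y, q_comm y x, q_comm z x] at this; revert this; cases q z w <;> cases q x z <;> cases q x y <;> cases q x w <;> cases q y w <;> cases q y z <;> simp
  · have := hf y hy z hz x hx w hw; rw [q_comm z x, q_comm y x] at this; revert this; cases q z w <;> cases q x z <;> cases q x y <;> cases q x w <;> cases q y w <;> cases q y z <;> simp
  · have := hf x hx y hy w hw z hz; rw [q_comm w z] at this; revert this; cases q z w <;> cases q x z <;> cases q x y <;> cases q x w <;> cases q y w <;> cases q y z <;> simp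
  · have := hf y hy x hx w hw z hz; rw [q_comm y x, q_comm w z] at this; revert this; cases q z w <;> cases q x z <;> cases q x y <;> cases q x w <;> cases q y w <;> cases q y z <;> simp
  · have := hf x hx z hz w hw y hy; rw [q_comm w y, q_comm z y] at this; revert this; cases q z w <;> cases q x z <;> cases q x y <;> cases q x w <;> cases q y w <;> cases q y z <;> simp
  · have := hf z hz x hx w hw y hy; rw [q_comm z x, q_comm w y, q_comm z y] at this; revert this; cases q z w <;> cases q x z <;> cases q x y <;> cases q x w <;> cases q y w <;> cases q y z <;> simp
  · have := hf z hz y hy w hw x hx; rw [q_comm z y, q_comm w x, q_comm z x, q_comm y x] at this; revert this; cases q z w <;> cases q x z <;> cases q x y <;> cases q x w <;> cases q y w <;> cases q y z <;> simp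
  · have := hf y hy z hz w hw x hx; rw [q_comm w x, q_comm y x, q_comm z x] at this; revert this; cases q z w <;> cases q x z <;> cases q x y <;> cases q x w <;> cases q y w <;> cases q y z <;> simp

/-- soundness of the two-edge kill rule -/
def K2Sound (k2 : Ent → Ent → ℕ) (HI : Finset ℕ) : Prop :=
  ∀ x ∈ HI, ∀ y ∈ HI, ∀ w ∈ HI, x ≠ y → tb (k2 (ent x) (ent y)) w = false

theorem killL_sound (HI : Finset ℕ) (hb : ∀ i ∈ HI, i < 120) (hf : FreeI HI) (x y w : ℕ)
    (hx : x ∈ HI) (hy : y ∈ HI) (hw : w ∈ HI) (l : List Ent) (hl : ∀ e ∈ l, ∃ z ∈ HI, e = ent z) (k : ℕ)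
    (hk : tb k w = false) :
    tb (killL (ent x) (ent y) (dis (ent x) (ent y)) l k) w = false := by
  induction l generalizing k with
  | nil => exact hk
  | cons e t ih =>
    obtain ⟨z, hz, rfl⟩ := hl e (by simp)
    refine ih (fun e he => hl e (by simp [he])) _ ?_
    rw [tb_lor, hk, kill3_sound HI hb hf x y z w hx hy hz hw]; rfl

theorem killOf_sound (k2 : Ent → Ent → ℕ) (HI : Finset ℕ) (hb : ∀ i ∈ HI, i < 120) (hf : FreeI HI)
    (h2 : K2Sound k2 HI) (x w : ℕ)
    (hx : x ∈ HI) (hw : w ∈ HI) (l : List Ent) (hl : ∀ e ∈ l, ∃ z ∈ HI, x ≠ z ∧ e = ent z) (k : ℕ)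
    (hk : tb k w = false) :
    tb (killOf k2 (ent x) l k) w = false := by
  induction l generalizing k with
  | nil => exact hk
  | cons e t ih =>
    obtain ⟨z, hz, hxz, rfl⟩ := hl e (by simp)
    refine ih (fun e he => hl e (by simp [he])) _ ?_
    refine killL_sound HI hb hf x z w hx hz hw t (fun e he => ?_) _ ?_
    · obtain ⟨z', h1, -, h3⟩ := hl e (by simp [he])
      exact ⟨z', h1, h3⟩
    · rw [tb_lor, hk, h2 x hx z hz w hw hxz]; rfl

theorem popc (m : ℕ) (X : ℕ) (hX : ∀ p, X.testBit p = true → ∃ j < m, p = 7 * j) :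
    X ≡ ∑ j ∈ range m, (tb X j).toNat [MOD 127] := by
  induction m generalizing X with
  | zero =>
    have : X = 0 := by
      apply Nat.eq_of_testBit_eq
      intro i
      by_contra h
      obtain ⟨j, hj, -⟩ := hX i (by simpa using h)
      omega
    subst this
    rfl
  | succ m ih =>
    have e1 : X % 2 ^ 7 = (tb X 0).toNat := by
      apply Nat.eq_of_testBit_eq
      intro i
      rw [Nat.testBit_mod_two_pow]
      rcases Nat.eq_zero_or_pos i with rfl | hi
      · cases h : tb X 0
        · simpa [tb] using h
        · simpa [tb] using h
      · have : (tb X 0).toNat.testBit i = false := by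
          cases tb X 0
          · simp
          · obtain ⟨k, rfl⟩ : ∃ k, i = k + 1 := ⟨i - 1, by omega⟩
            simp [Nat.testBit_add_one]
        rw [this]
        by_contra h
        simp only [Bool.not_eq_false, Bool.and_eq_true, decide_eq_true_eq] at h
        obtain ⟨j, -, hj⟩ := hX i h.2
        omega
    have e2 : X = 128 * (X / 2 ^ 7) + X % 2 ^ 7 := by omega
    have h3 := ih (X / 2 ^ 7) (fun p hp => by
      rw [Nat.testBit_div_two_pow] at hp
      obtain ⟨j, hj, hj'⟩ := hX _ hp
      exact ⟨j - 1, by omega, by omega⟩)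
    rw [sum_range_succ', ← e1]
    have h4 : ∀ j, tb (X / 2 ^ 7) j = tb X (j + 1) := by
      intro j
      rw [tb, tb, Nat.testBit_div_two_pow]; congr 1; 
    simp only [h4] at h3
    conv_lhs => rw [e2]
    refine Nat.ModEq.add_right _ ?_
    calc 128 * (X / 2 ^ 7) ≡ 1 * (X / 2 ^ 7) [MOD 127] := Nat.ModEq.mul_right _ (by decide)
      _ ≡ _ [MOD 127] := by rw [one_mul]; exact h3

set_option exponentiation.threshold 1000 in
theorem full_bits' (p : ℕ) (h : (full 120).testBit p = true) : ∃ j < 120, p = 7 * j := by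
  by_cases hp : p < 840
  · rw [full_bits p hp] at h
    simp only [decide_eq_true_eq] at h
    exact ⟨p / 7, by omega, by omega⟩
  · exfalso
    have h1 : full 120 < 2 ^ 840 := by decide +kernel
    rw [Nat.testBit_lt_two_pow (lt_of_lt_of_le h1 (Nat.pow_le_pow_right (by norm_num) (by omega)))] at h
    exact absurd h (by simp)

theorem popc' (X : ℕ) (hX : Nat.land X (full 120) = X) :
    X % 127 = ((range 120).filter (fun j => tb X j = true)).card := by
  have := popc 120 X (fun p hp => by
    apply full_bits'
    have h : (Nat.land X (full 120)).testBit p = (X.testBit p && (full 120).testBit p) := Nat.testBit_and ..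
    rw [hX, hp] at h
    simpa using h.symm)
  have e : ∑ j ∈ range 120, (tb X j).toNat = ((range 120).filter (fun j => tb X j = true)).card := by
    rw [card_filter]
    refine sum_congr rfl fun j _ => ?_
    cases tb X j <;> rfl
  rw [e] at this
  have h2 : ((range 120).filter (fun j => tb X j = true)).card ≤ 120 := by
    simpa using card_filter_le (range 120) (fun j => tb X j = true)
  rw [this, Nat.mod_eq_of_lt (by omega)]

def CondsOK (cs : List (ℕ × ℕ)) : Prop := ∀ c ∈ cs, Nat.land c.1 (full 120) = c.1

theorem dead_sound (HI : Finset ℕ) (hb : ∀ i ∈ HI, i < 120) (cs : List (ℕ × ℕ)) (hc : CondsOK cs) (av : ℕ)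
    (hav : ∀ j ∈ HI, tb av j = true) (h : dead cs av = true) :
    ∃ c ∈ cs, (HI.filter (fun j => tb c.1 j = true)).card < c.2 := by
  induction cs with
  | nil => exact absurd h (by simp [dead])
  | cons c t ih =>
    have h' : cond (Nat.ble c.2 (Nat.mod (Nat.land av c.1) 127)) (dead t av) true = true := h
    cases hh : Nat.ble c.2 (Nat.mod (Nat.land av c.1) 127)
    · refine ⟨c, by simp, ?_⟩
      have h1 : (Nat.land av c.1) % 127 < c.2 := by
        rw [← Bool.not_eq_true, Nat.ble_eq] at hh
        exact not_le.1 hh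
      rw [popc'] at h1
      · refine lt_of_le_of_lt (card_le_card ?_) h1
        intro j hj
        simp only [mem_filter, mem_range, tb_land, Bool.and_eq_true] at hj ⊢
        exact ⟨hb j hj.1, hav j hj.1, hj.2⟩
      · have := hc c (by simp)
        show (av &&& c.1) &&& full 120 = av &&& c.1
        rw [Nat.and_assoc]; congr 1
    · rw [hh] at h'
      obtain ⟨c', hc', h2⟩ := ih (fun c hc' => hc c (by simp [hc'])) h'
      exact ⟨c', by simp [hc'], h2⟩

theorem tb_ent_b (i j : ℕ) : tb (ent i).b j = decide (i = j) := tb_pow i j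

theorem b_bits (i p : ℕ) (h : (ent i).b.testBit p = true) : p = 7 * i := by
  have h' : (128 ^ i).testBit p = true := h
  have : (128 : ℕ) ^ i = 2 ^ (7 * i) := by rw [pow_mul]; norm_num
  rw [this, Nat.testBit_two_pow] at h'
  simpa using (of_decide_eq_true h').symm

structure SInv (HI : Finset ℕ) (l : List Ent) (inm av : ℕ) : Prop where
  hl : ∀ e ∈ l, ∃ z ∈ HI, tb inm z = true ∧ e = ent z
  hinm : ∀ p, inm.testBit p = true → ∃ j ∈ HI, p = 7 * j
  hav : ∀ j ∈ HI, tb av j = true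

theorem SInv.add {k2 : Ent → Ent → ℕ} {HI : Finset ℕ} (hb : ∀ i ∈ HI, i < 120) (hf : FreeI HI)
    (h2 : K2Sound k2 HI) {l : List Ent} {inm av : ℕ} (h : SInv HI l inm av) (i : ℕ) (hi : i ∈ HI)
    (hn : tb inm i = false) :
    Nat.beq (Nat.land (killOf k2 (ent i) l 0) inm) 0 = true ∧
    SInv HI (ent i :: l) (Nat.lor inm (ent i).b) (Nat.xor av (Nat.land av (killOf k2 (ent i) l 0))) := by
  have hk : ∀ w ∈ HI, tb (killOf k2 (ent i) l 0) w = false := fun w hw =>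
    killOf_sound k2 HI hb hf h2 i w hi hw l (fun e he => by
      obtain ⟨z, hz, h3, h4⟩ := h.hl e he
      refine ⟨z, hz, ?_, h4⟩
      rintro rfl
      rw [hn] at h3; exact absurd h3 (by simp)) 0 (tb_zero w)
  refine ⟨?_, ?_, ?_, ?_⟩
  · rw [Nat.beq_eq]
    apply Nat.eq_of_testBit_eq
    intro p
    have e : (Nat.land (killOf k2 (ent i) l 0) inm).testBit p = ((killOf k2 (ent i) l 0).testBit p && inm.testBit p) := Nat.testBit_and ..
    rw [e]
    cases hp : inm.testBit p
    · simp
    · obtain ⟨j, hj, rfl⟩ := h.hinm p hp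
      have := hk j hj
      rw [tb] at this
      simp [this]
  · intro e he
    rcases List.mem_cons.1 he with rfl | he
    · exact ⟨i, hi, by rw [tb_lor, tb_ent_b]; simp, rfl⟩
    · obtain ⟨z, hz, h3, h4⟩ := h.hl e he
      exact ⟨z, hz, by rw [tb_lor, h3]; rfl, h4⟩
  · intro p hp
    have e : (Nat.lor inm (ent i).b).testBit p = (inm.testBit p || (ent i).b.testBit p) := Nat.testBit_or ..
    rw [e, Bool.or_eq_true] at hp
    rcases hp with hp | hp
    · exact h.hinm p hp
    · exact ⟨i, hi, b_bits i p hp⟩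
  · intro j hj
    rw [tb_xor, tb_land, hk j hj, h.hav j hj]; rfl

theorem SInv.drop {HI : Finset ℕ} {l : List Ent} {inm av : ℕ} (h : SInv HI l inm av) (i : ℕ) (hi : i ∉ HI) :
    SInv HI l inm (Nat.xor av (ent i).b) := by
  refine ⟨h.hl, h.hinm, fun j hj => ?_⟩
  have : i ≠ j := by rintro rfl; exact hi hj
  rw [tb_xor, tb_ent_b, h.hav j hj]; simp [this]

theorem go_sound (k2 : Ent → Ent → ℕ) (cs : List (ℕ × ℕ)) (hc : CondsOK cs) (HI : Finset ℕ)
    (hb : ∀ i ∈ HI, i < 120) (hf : FreeI HI) (h2 : K2Sound k2 HI) (ord : List ℕ)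
    (l : List Ent) (inm av : ℕ) (h : SInv HI l inm av) (hnd : ord.Nodup) (hno : ∀ i ∈ ord, tb inm i = false)
    (hg : go k2 cs ord l inm av = true) :
    ∃ c ∈ cs, (HI.filter (fun j => tb c.1 j = true)).card < c.2 := by
  induction ord generalizing l inm av with
  | nil => exact dead_sound HI hb cs hc av h.hav hg
  | cons i t ih =>
    have hg' : cond (Nat.beq (Nat.land av (ent i).b) 0) (go k2 cs t l inm av)
        (cond (cond (Nat.beq (Nat.land (killOf k2 (ent i) l 0) inm) 0)
          (cond (dead cs (Nat.xor av (Nat.land av (killOf k2 (ent i) l 0)))) true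
            (go k2 cs t (ent i :: l) (Nat.lor inm (ent i).b) (Nat.xor av (Nat.land av (killOf k2 (ent i) l 0))))) true)
          (cond (dead cs (Nat.xor av (ent i).b)) true (go k2 cs t l inm (Nat.xor av (ent i).b))) false) = true := hg
    have hno' : ∀ i ∈ t, tb inm i = false := fun i hi => hno i (by simp [hi])
    have hnd' := (List.nodup_cons.1 hnd).2
    cases h0 : Nat.beq (Nat.land av (ent i).b) 0
    · rw [h0] at hg'
      replace hg' : cond (cond (Nat.beq (Nat.land (killOf k2 (ent i) l 0) inm) 0)
          (cond (dead cs (Nat.xor av (Nat.land av (killOf k2 (ent i) l 0)))) true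
            (go k2 cs t (ent i :: l) (Nat.lor inm (ent i).b) (Nat.xor av (Nat.land av (killOf k2 (ent i) l 0))))) true)
          (cond (dead cs (Nat.xor av (ent i).b)) true (go k2 cs t l inm (Nat.xor av (ent i).b))) false = true := hg'
      rw [Bool.cond_false_right, Bool.and_eq_true] at hg'
      by_cases hi : i ∈ HI
      · obtain ⟨h3, h4⟩ := h.add hb hf h2 i hi (hno i (by simp))
        have h5 := hg'.1
        rw [h3, cond_true] at h5
        cases h6 : dead cs (Nat.xor av (Nat.land av (killOf k2 (ent i) l 0)))
        · rw [h6, cond_false] at h5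
          refine ih _ _ _ h4 hnd' (fun j hj => ?_) h5
          have : i ≠ j := by rintro rfl; exact (List.nodup_cons.1 hnd).1 hj
          rw [tb_lor, hno' j hj, tb_ent_b]; simp [this]
        · exact dead_sound HI hb cs hc _ h4.hav h6
      · have h4 := h.drop i hi
        have h5 := hg'.2
        cases h6 : dead cs (Nat.xor av (ent i).b)
        · rw [h6, cond_false] at h5
          exact ih _ _ _ h4 hnd' hno' h5
        · exact dead_sound HI hb cs hc _ h4.hav h6
    · rw [h0, cond_true] at hg'
      exact ih l inm av h hnd' hno' hg'

theorem start_sound (k2 : Ent → Ent → ℕ) (cs : List (ℕ × ℕ)) (hc : CondsOK cs) (HI : Finset ℕ)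
    (hb : ∀ i ∈ HI, i < 120) (hf : FreeI HI) (h2 : K2Sound k2 HI) (ord roots : List ℕ) (hr : ∀ r ∈ roots, r ∈ HI)
    (l : List Ent) (inm av : ℕ) (h : SInv HI l inm av) (hnd : (roots ++ ord).Nodup)
    (hno : ∀ i ∈ roots ++ ord, tb inm i = false)
    (hg : start k2 cs ord roots l inm av = true) :
    ∃ c ∈ cs, (HI.filter (fun j => tb c.1 j = true)).card < c.2 := by
  induction roots generalizing l inm av with
  | nil =>
    have hg' : cond (dead cs av) true (go k2 cs ord l inm av) = true := hg
    cases h6 : dead cs av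
    · rw [h6, cond_false] at hg'
      exact go_sound k2 cs hc HI hb hf h2 ord l inm av h hnd hno hg'
    · exact dead_sound HI hb cs hc _ h.hav h6
  | cons i t ih =>
    obtain ⟨h3, h4⟩ := h.add hb hf h2 i (hr i (by simp)) (hno i (by simp))
    have hnd' := List.nodup_cons.1 hnd
    refine ih (fun r h => hr r (by simp [h])) _ _ _ h4 hnd'.2 (fun j hj => ?_) hg
    have : i ≠ j := by rintro rfl; exact hnd'.1 hj
    rw [tb_lor, hno j (List.mem_cons_of_mem _ hj), tb_ent_b]; simp [this]

/-- the complete check -/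
noncomputable def chk (k2 : Ent → Ent → ℕ) (m : ℕ) (cs : List (ℕ × ℕ)) (ord roots : List ℕ) : Bool :=
  start k2 cs ord roots [] 0 (full m)

theorem chk_sound {k2 : Ent → Ent → ℕ} {m : ℕ} {cs : List (ℕ × ℕ)} {ord roots : List ℕ}
    (hg : chk k2 m cs ord roots = true) (hc : CondsOK cs) (hnd : (roots ++ ord).Nodup)
    (hm : ∀ j < m, j < 120 ∧ tb (full m) j = true) {HI : Finset ℕ}
    (hb : ∀ i ∈ HI, i < m) (hf : FreeI HI) (h2 : K2Sound k2 HI) (hr : ∀ r ∈ roots, r ∈ HI) :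
    ∃ c ∈ cs, (HI.filter (fun j => tb c.1 j = true)).card < c.2 :=
  start_sound k2 cs hc HI (fun i hi => (hm i (hb i hi)).1) hf h2 ord roots hr [] 0 (full m)
    ⟨by simp, by simp, fun j hj => (hm j (hb j hj)).2⟩ hnd (fun i _ => tb_zero i) hg

noncomputable def condsA (m t : ℕ) (X : List (ℕ × ℕ)) : List (ℕ × ℕ) :=
  (full m, t) :: (Nat.land (full m) (stm 0), t - 4) :: X
noncomputable def xSP (m : ℕ) : ℕ := Nat.land (full m) (Nat.xor (full 120)
  (Nat.lor (Nat.land (stm 0) (Nat.lor (stm 1) (Nat.lor (stm 2) (Nat.lor (stm 3) (Nat.lor (stm 4) (stm 5))))))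
    (Nat.lor (ent 3).b (ent 17).b)))
noncomputable def xSK (m : ℕ) : ℕ := Nat.land (full m) (Nat.xor (full 120)
  (Nat.lor (Nat.land (stm 0) (Nat.lor (stm 1) (Nat.lor (stm 2) (Nat.lor (stm 3) (stm 4)))))
    (Nat.lor (ent 3).b (Nat.lor (ent 6).b (Nat.lor (ent 8).b (ent 9).b)))))

def GoodNM (n m : ℕ) : Prop := (n = 9 ∧ m = 84) ∨ (n = 10 ∧ m = 120)

def Res (n m : ℕ) (k2 : Ent → Ent → ℕ) (roots : List ℕ) : Prop :=
  ∃ cs ord, CondsOK cs ∧ (∀ c ∈ cs, c = (full m, 4 * n - 10) ∨ ∃ v < n, c = (avoid m v, 5)) ∧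
    (roots ++ ord).Nodup ∧ chk k2 m cs ord roots = true

def ResA (n m : ℕ) (X : List (ℕ × ℕ)) (roots : List ℕ) : Prop :=
  ∃ ord, CondsOK (condsA m (4 * n - 10) X) ∧
    (roots ++ ord).Nodup ∧ chk k2_0 m (condsA m (4 * n - 10) X) ord roots = true

theorem conds9_ok : CondsOK conds9 ∧ ∀ c ∈ conds9, c = (full 84, 4 * 9 - 10) ∨ ∃ v < 9, c = (avoid 84 v, 5) := by
  constructor
  · unfold CondsOK conds9; decide +kernel
  · unfold conds9
    generalize avoid 84 = g
    generalize full 84 = z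
    intro c hc
    simp only [List.mem_cons, List.not_mem_nil, or_false] at hc
    rcases hc with h | h | h | h | h | h | h | h | h | h
    · exact Or.inl h
    all_goals exact Or.inr ⟨_, by norm_num, h⟩

theorem conds10_ok : CondsOK conds10 ∧ ∀ c ∈ conds10, c = (full 120, 4 * 10 - 10) ∨ ∃ v < 10, c = (avoid 120 v, 5) := by
  constructor
  · unfold CondsOK conds10; decide +kernel
  · unfold conds10
    generalize avoid 120 = g
    generalize full 120 = z
    intro c hc
    simp only [List.mem_cons, List.not_mem_nil, or_false] at hc
    rcases hc with h | h | h | h | h | h | h | h | h | h | h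
    · exact Or.inl h
    all_goals exact Or.inr ⟨_, by norm_num, h⟩

theorem res00_9 : Res 9 84 k2_0 [0, 19, 83] :=
  ⟨conds9, [57, 16, 70, 20, 7, 6, 15, 81, 35, 10, 33, 29, 48, 12, 54, 1, 34, 5, 3, 79, 80, 74, 2, 17, 69, 49, 13, 52, 22, 58, 71, 50, 78, 8, 65, 21, 72, 77, 53, 51, 76, 55, 56, 11, 82, 44, 37, 14, 18, 75, 9, 4, 73, 36, 42, 25, 63, 66, 47, 59, 27, 23, 30, 60, 46, 28, 62, 39, 67, 45, 43, 64, 31, 32, 26, 38, 61, 24, 40, 41, 68],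
    conds9_ok.1, conds9_ok.2, by decide +kernel, by decide +kernel⟩
theorem res00_10 : Res 10 120 k2_0 [0, 19, 83] :=
  ⟨conds10, [97, 84, 101, 119, 90, 27, 98, 86, 85, 89, 68, 118, 102, 106, 93, 95, 111, 112, 116, 113, 107, 92, 99, 110, 100, 114, 94, 104, 105, 37, 88, 91, 96, 87, 56, 17, 21, 115, 9, 109, 12, 103, 13, 5, 72, 117, 3, 108, 10, 18, 74, 52, 14, 16, 81, 55, 70, 33, 75, 44, 78, 71, 34, 65, 11, 22, 76, 69, 49, 50, 82, 73, 29, 6, 4, 54, 58, 15, 80, 8, 48, 53, 2, 51, 79, 35, 1, 20, 36, 31, 32, 59, 25, 39, 57, 45, 62, 47, 64, 24, 42, 40, 28, 30, 41, 77, 7, 61, 66, 67, 23, 38, 46, 60, 63, 43, 26],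
    conds10_ok.1, conds10_ok.2, by decide +kernel, by decide +kernel⟩
theorem res00 (n m : ℕ) (h : GoodNM n m) : Res n m k2_0 [0, 19, 83] := by
  rcases h with ⟨rfl, rfl⟩ | ⟨rfl, rfl⟩
  · exact res00_9
  · exact res00_10
theorem res01_9 : Res 9 84 k2_1 [0, 19, 50] :=
  ⟨conds9, [79, 78, 73, 69, 65, 72, 52, 77, 56, 70, 51, 37, 22, 39, 40, 31, 62, 25, 46, 28, 42, 66, 59, 27, 47, 24, 16, 13, 20, 38, 41, 26, 10, 43, 21, 35, 4, 57, 36, 5, 30, 11, 32, 23, 2, 71, 7, 45, 1],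
    conds9_ok.1, conds9_ok.2, by decide +kernel, by decide +kernel⟩
theorem res01_10 : Res 10 120 k2_1 [0, 19, 50] :=
  ⟨conds10, [117, 112, 73, 100, 78, 107, 115, 106, 116, 79, 101, 72, 51, 70, 93, 97, 69, 65, 52, 98, 22, 37, 24, 47, 25, 42, 31, 43, 27, 40, 66, 59, 46, 28, 62, 90, 39, 32, 94, 7, 45, 41, 2, 38, 5, 1, 84, 10, 13, 23, 36, 4, 16, 21, 99, 20, 85, 87, 71, 57, 30, 77, 56, 105, 35, 11, 26],
    conds10_ok.1, conds10_ok.2, by decide +kernel, by decide +kernel⟩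
theorem res01 (n m : ℕ) (h : GoodNM n m) : Res n m k2_1 [0, 19, 50] := by
  rcases h with ⟨rfl, rfl⟩ | ⟨rfl, rfl⟩
  · exact res01_9
  · exact res01_10
theorem res11_9 : Res 9 84 k2_3 [0, 19, 23] :=
  ⟨conds9, [68, 63, 64, 67, 43, 34, 46, 42, 47, 22, 57, 56, 6, 12, 48, 44, 18, 17, 29, 33, 31, 28, 61, 39, 32, 36, 41, 66, 27, 45, 60, 35, 40, 69, 62, 65, 20, 24, 25, 14, 16, 1, 59, 4, 5, 15, 38, 30, 21, 8, 13, 11, 7, 2, 9, 26, 3, 10],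
    conds9_ok.1, conds9_ok.2, by decide +kernel, by decide +kernel⟩
theorem res11_10 : Res 10 120 k2_3 [0, 19, 23] :=
  ⟨conds10, [95, 96, 91, 34, 63, 68, 92, 22, 67, 64, 93, 97, 35, 56, 36, 42, 43, 46, 47, 31, 28, 61, 39, 27, 32, 29, 33, 57, 6, 12, 18, 17, 94, 62, 88, 41, 40, 45, 60, 89, 44, 26, 65, 85, 84, 5, 20, 30, 87, 9, 24, 66, 1, 8, 4, 25, 15, 59, 13, 48, 11, 21, 7, 10, 69, 38, 90, 14, 3, 16, 2],
    conds10_ok.1, conds10_ok.2, by decide +kernel, by decide +kernel⟩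
theorem res11 (n m : ℕ) (h : GoodNM n m) : Res n m k2_3 [0, 19, 23] := by
  rcases h with ⟨rfl, rfl⟩ | ⟨rfl, rfl⟩
  · exact res11_9
  · exact res11_10
theorem res02_9 : Res 9 84 k2_11 [0, 19, 20] :=
  ⟨conds9, [],
    conds9_ok.1, conds9_ok.2, by decide +kernel, by decide +kernel⟩
theorem res02_10 : Res 10 120 k2_11 [0, 19, 20] :=
  ⟨conds10, [],
    conds10_ok.1, conds10_ok.2, by decide +kernel, by decide +kernel⟩
theorem res02 (n m : ℕ) (h : GoodNM n m) : Res n m k2_11 [0, 19, 20] := by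
  rcases h with ⟨rfl, rfl⟩ | ⟨rfl, rfl⟩
  · exact res02_9
  · exact res02_10
theorem res12_9 : Res 9 84 k2_11 [0, 19, 1] :=
  ⟨conds9, [65, 48, 7, 18, 6, 29, 11, 44, 20, 69, 4, 35, 3, 56, 16, 33, 9, 10, 8, 2, 17, 14, 15, 5, 12, 13],
    conds9_ok.1, conds9_ok.2, by decide +kernel, by decide +kernel⟩
theorem res12_10 : Res 10 120 k2_11 [0, 19, 1] :=
  ⟨conds10, [5, 9, 69, 3, 56, 7, 35, 97, 16, 93, 20, 11, 2, 65, 18, 10, 12, 13, 33, 84, 8, 48, 6, 29, 17, 14, 4, 44, 15],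
    conds10_ok.1, conds10_ok.2, by decide +kernel, by decide +kernel⟩
theorem res12 (n m : ℕ) (h : GoodNM n m) : Res n m k2_11 [0, 19, 1] := by
  rcases h with ⟨rfl, rfl⟩ | ⟨rfl, rfl⟩
  · exact res12_9
  · exact res12_10
theorem resI2_9 : Res 9 84 k2_99 [0, 1] :=
  ⟨conds9, [30, 61, 62, 71, 72, 25, 27, 67, 78, 66, 63, 57, 60, 58, 9, 15, 31, 26, 17, 22, 51, 6, 12, 46, 37, 8, 24, 40, 21, 10, 23, 41, 14, 5, 50, 77, 2, 45, 7, 20, 42, 13, 59, 38, 3, 35, 56, 11, 16, 36, 39, 4],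
    conds9_ok.1, conds9_ok.2, by decide +kernel, by decide +kernel⟩
theorem resI2_10 : Res 10 120 k2_99 [0, 1] :=
  ⟨conds10, [50, 71, 25, 100, 31, 26, 51, 99, 24, 30, 15, 94, 17, 46, 38, 21, 37, 89, 9, 61, 40, 23, 45, 14, 11, 16, 13, 77, 41, 105, 66, 2, 90, 85, 36, 5, 62, 57, 59, 20, 39, 106, 67, 88, 78, 56, 12, 7, 63, 58, 91, 95, 112, 84, 60, 42, 6, 22, 72, 113, 10, 4, 8, 3, 86, 27, 87, 35],
    conds10_ok.1, conds10_ok.2, by decide +kernel, by decide +kernel⟩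
theorem resI2 (n m : ℕ) (h : GoodNM n m) : Res n m k2_99 [0, 1] := by
  rcases h with ⟨rfl, rfl⟩ | ⟨rfl, rfl⟩
  · exact resI2_9
  · exact resI2_10
theorem resI1_9 : Res 9 84 k2_99 [0, 7] :=
  ⟨conds9, [64, 17, 15, 66, 18, 60, 30, 14, 45, 27, 25, 71, 24, 28, 63, 61, 40, 9, 43, 39, 5, 56, 16, 50, 21, 11, 59, 35, 20, 1, 57, 36, 42, 4, 77, 8, 2, 3, 41, 38, 62, 26, 10, 13, 6, 23],
    conds9_ok.1, conds9_ok.2, by decide +kernel, by decide +kernel⟩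
theorem resI1_10 : Res 10 120 k2_99 [0, 7] :=
  ⟨conds10, [39, 45, 18, 25, 27, 14, 43, 30, 50, 94, 42, 15, 17, 28, 105, 40, 24, 92, 88, 91, 63, 60, 3, 64, 6, 77, 8, 23, 90, 56, 85, 20, 1, 38, 99, 10, 84, 89, 112, 66, 41, 61, 9, 2, 11, 62, 57, 59, 36, 71, 5, 13, 35, 16, 87, 21, 4, 26],
    conds10_ok.1, conds10_ok.2, by decide +kernel, by decide +kernel⟩
theorem resI1 (n m : ℕ) (h : GoodNM n m) : Res n m k2_99 [0, 7] := by
  rcases h with ⟨rfl, rfl⟩ | ⟨rfl, rfl⟩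
  · exact resI1_9
  · exact resI1_10
theorem resA0_9 : ResA 9 84 [] [3, 34] :=
  ⟨[16, 45, 36, 35, 57, 26, 0, 31, 78, 61, 48, 12, 10, 4, 66, 7, 25, 50, 73, 60, 53, 42, 69, 20, 14, 51, 22, 44, 41, 55, 47, 11, 5, 32, 30, 58, 37, 64, 15, 67, 52, 40, 68, 74, 8, 24, 62, 76, 23, 71, 43, 79, 56, 83, 46, 33, 29, 54, 59, 72, 1, 17, 75, 81, 63, 2, 65, 49, 82, 28, 27, 39, 77, 9, 38, 6, 21, 80, 13, 70, 18, 19],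
    by unfold CondsOK condsA; decide +kernel, by decide +kernel, by decide +kernel⟩
theorem resA0_10 : ResA 10 120 [] [3, 34] :=
  ⟨[57, 84, 45, 36, 30, 35, 50, 38, 1, 0, 85, 81, 87, 11, 22, 19, 108, 42, 76, 100, 12, 107, 54, 78, 79, 82, 16, 28, 116, 93, 67, 33, 63, 102, 18, 27, 109, 89, 94, 68, 62, 64, 73, 110, 119, 99, 56, 97, 106, 8, 65, 43, 103, 13, 83, 47, 118, 66, 75, 9, 49, 72, 37, 111, 23, 51, 25, 105, 21, 96, 92, 44, 29, 4, 98, 91, 20, 113, 80, 69, 74, 24, 70, 46, 104, 14, 53, 17, 117, 41, 101, 115, 48, 2, 52, 31, 5, 39, 15, 86, 95, 59, 6, 58, 26, 55, 10, 88, 32, 71, 90, 7, 114, 40, 77, 61, 112, 60],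
    by unfold CondsOK condsA; decide +kernel, by decide +kernel, by decide +kernel⟩
theorem resA0 (n m : ℕ) (h : GoodNM n m) : ResA n m [] [3, 34] := by
  rcases h with ⟨rfl, rfl⟩ | ⟨rfl, rfl⟩
  · exact resA0_9
  · exact resA0_10
theorem resA1_9 : ResA 9 84 [(xSP 84, 1)] [3, 17] :=
  ⟨[34, 25, 71, 52, 23, 80, 73, 74, 53, 76, 81, 26, 54, 75, 55, 79, 82, 50, 21, 38, 57, 18, 19, 45, 62, 30, 41, 66, 56, 15, 27, 65, 60, 14, 67, 10, 43, 31, 37, 51, 29, 32, 36, 47, 8, 72, 78, 70, 9, 48, 59, 28, 68, 16, 69, 20, 33, 44, 12, 22, 7, 58, 0, 42, 13, 46, 39, 11, 24, 83, 1, 35, 40, 64, 5, 4, 77, 6, 61, 2, 49, 63],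
    by unfold CondsOK condsA; decide +kernel, by decide +kernel, by decide +kernel⟩
theorem resA1_10 : ResA 10 120 [(xSP 120, 1)] [3, 17] :=
  ⟨[112, 99, 105, 50, 52, 74, 34, 61, 115, 55, 114, 70, 77, 103, 98, 117, 82, 75, 53, 81, 71, 79, 107, 110, 54, 76, 108, 116, 73, 80, 101, 109, 49, 104, 102, 59, 21, 63, 48, 66, 91, 47, 41, 36, 24, 39, 37, 38, 18, 19, 94, 83, 26, 62, 106, 100, 95, 31, 72, 111, 33, 30, 78, 46, 27, 15, 9, 58, 8, 86, 12, 43, 64, 68, 92, 60, 57, 87, 20, 40, 10, 7, 22, 25, 45, 65, 0, 44, 11, 2, 85, 5, 67, 84, 4, 89, 28, 119, 118, 14, 35, 6, 88, 56, 13, 113, 32, 97, 29, 1, 51, 93, 69, 90, 23, 42, 96, 16],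
    by unfold CondsOK condsA; decide +kernel, by decide +kernel, by decide +kernel⟩
theorem resA1 (n m : ℕ) (h : GoodNM n m) : ResA n m [(xSP m, 1)] [3, 17] := by
  rcases h with ⟨rfl, rfl⟩ | ⟨rfl, rfl⟩
  · exact resA1_9
  · exact resA1_10
theorem resA2_9 : ResA 9 84 [(xSK 84, 1)] [3, 6] :=
  ⟨[77, 16, 71, 30, 41, 59, 38, 63, 36, 10, 73, 69, 76, 20, 43, 12, 78, 40, 21, 29, 24, 65, 75, 42, 44, 83, 19, 4, 48, 57, 7, 67, 5, 51, 13, 55, 11, 47, 61, 60, 70, 53, 37, 0, 23, 74, 25, 52, 79, 28, 14, 32, 50, 34, 17, 33, 49, 31, 2, 9, 1, 68, 64, 18, 56, 82, 15, 45, 39, 27, 26, 8, 62, 46, 81, 54, 22, 80, 66, 35, 72, 58],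
    by unfold CondsOK condsA; decide +kernel, by decide +kernel, by decide +kernel⟩
theorem resA2_10 : ResA 10 120 [(xSK 120, 1)] [3, 6] :=
  ⟨[90, 71, 45, 99, 38, 59, 62, 112, 94, 23, 13, 85, 28, 21, 35, 116, 108, 64, 113, 18, 10, 110, 54, 98, 93, 114, 111, 74, 68, 19, 89, 83, 43, 63, 106, 29, 44, 81, 49, 95, 101, 102, 75, 32, 67, 92, 40, 65, 87, 20, 69, 66, 31, 25, 119, 70, 82, 2, 55, 4, 84, 53, 26, 77, 47, 118, 17, 57, 37, 76, 115, 103, 22, 88, 117, 86, 91, 16, 14, 48, 39, 60, 78, 27, 36, 11, 8, 50, 41, 100, 51, 7, 52, 79, 96, 56, 109, 73, 46, 5, 33, 61, 34, 58, 12, 80, 30, 15, 105, 42, 0, 72, 9, 1, 24, 97, 107, 104],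
    by unfold CondsOK condsA; decide +kernel, by decide +kernel, by decide +kernel⟩
theorem resA2 (n m : ℕ) (h : GoodNM n m) : ResA n m [(xSK m, 1)] [3, 6] := by
  rcases h with ⟨rfl, rfl⟩ | ⟨rfl, rfl⟩
  · exact resA2_9
  · exact resA2_10

theorem GoodNM.le {n m : ℕ} (h : GoodNM n m) : m ≤ 120 := by
  rcases h with ⟨rfl, rfl⟩ | ⟨rfl, rfl⟩ <;> norm_num
theorem GoodNM.le10 {n m : ℕ} (h : GoodNM n m) : n ≤ 10 ∧ 9 ≤ n := by
  rcases h with ⟨rfl, rfl⟩ | ⟨rfl, rfl⟩ <;> norm_num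

theorem GoodNM.full_tb {n m : ℕ} (h : GoodNM n m) (j : ℕ) (hj : j < m) : j < 120 ∧ tb (full m) j = true := by
  refine ⟨lt_of_lt_of_le hj h.le, ?_⟩
  rcases h with ⟨rfl, rfl⟩ | ⟨rfl, rfl⟩
  · rw [full84_tb j (by omega)]; simpa using hj
  · exact _root_.full_tb j hj

theorem E_sub {n m : ℕ} (h : GoodNM n m) (i : ℕ) (hi : i < m) : E i ⊆ range n := by
  obtain ⟨h1, h2, h3⟩ := E_dig i (lt_of_lt_of_le hi h.le)
  have h4 : codeAt i % 10 < n := by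
    rcases h with ⟨rfl, rfl⟩ | ⟨rfl, rfl⟩
    · exact E_lt9 i hi
    · exact h3
  intro v hv
  simp only [E, mem_insert, mem_singleton] at hv
  rw [mem_range]; omega

theorem E_card (i : ℕ) (hi : i < 120) : (E i).card = 3 := by
  obtain ⟨h1, h2, h3⟩ := E_dig i hi
  rw [E, card_eq_three]
  exact ⟨_, _, _, by omega, by omega, by omega, rfl⟩

theorem code_dec (i : ℕ) (hi : i < 120) : codeAt i = 100 * (codeAt i / 100) + 10 * (codeAt i / 10 % 10) + codeAt i % 10 := by
  omega

theorem E_inj (i j : ℕ) (hi : i < 120) (hj : j < 120) (h : E i = E j) : i = j := by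
  apply code_inj i hi j hj
  obtain ⟨h1, h2, h3⟩ := E_dig i hi
  obtain ⟨g1, g2, g3⟩ := E_dig j hj
  rw [code_dec i hi, code_dec j hj]
  rw [E, E] at h
  generalize codeAt i / 100 = a at *
  generalize codeAt i / 10 % 10 = b at *
  generalize codeAt i % 10 = c at *
  generalize codeAt j / 100 = a' at *
  generalize codeAt j / 10 % 10 = b' at *
  generalize codeAt j % 10 = c' at *
  have ha : a ∈ ({a', b', c'} : Finset ℕ) := by rw [← h]; simp
  have hb : b ∈ ({a', b', c'} : Finset ℕ) := by rw [← h]; simp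
  have hc : c ∈ ({a', b', c'} : Finset ℕ) := by rw [← h]; simp
  simp only [mem_insert, mem_singleton] at ha hb hc
  omega

theorem E_surj3 {n m : ℕ} (h : GoodNM n m) (a b c : ℕ) (ab : a < b) (bc : b < c) (hc : c < n) :
    ∃ i < m, E i = {a, b, c} := by
  obtain ⟨i, h1, h2, h3⟩ := E_surj c (by have := h.le10; omega) b bc a ab
  refine ⟨i, ?_, ?_⟩
  · rcases h with ⟨rfl, rfl⟩ | ⟨rfl, rfl⟩
    · exact h2 hc
    · exact h1
  · have := h.le10
    rw [E, show codeAt i / 100 = a by omega, show codeAt i / 10 % 10 = b by omega, show codeAt i % 10 = c by omega]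

theorem E_surj' {n m : ℕ} (h : GoodNM n m) (s : Finset ℕ) (hs : s ⊆ range n) (h3 : s.card = 3) :
    ∃ i < m, E i = s := by
  obtain ⟨x, y, z, hxy, hxz, hyz, rfl⟩ := card_eq_three.1 h3
  have hx : x < n := mem_range.1 (hs (by simp))
  have hy : y < n := mem_range.1 (hs (by simp))
  have hz : z < n := mem_range.1 (hs (by simp))
  rcases lt_or_gt_of_ne hxy with h1 | h1 <;> rcases lt_or_gt_of_ne hxz with h2 | h2 <;>
    rcases lt_or_gt_of_ne hyz with h4 | h4
  · exact E_surj3 h x y z h1 h4 hz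
  · obtain ⟨i, hi, e⟩ := E_surj3 h x z y h2 h4 hy
    exact ⟨i, hi, by rw [e]; ext; simp; tauto⟩
  · omega
  · obtain ⟨i, hi, e⟩ := E_surj3 h z x y h2 h1 hy
    exact ⟨i, hi, by rw [e]; ext; simp; tauto⟩
  · obtain ⟨i, hi, e⟩ := E_surj3 h y x z h1 h2 hz
    exact ⟨i, hi, by rw [e]; ext; simp; tauto⟩
  · omega
  · obtain ⟨i, hi, e⟩ := E_surj3 h y z x h4 h2 hx
    exact ⟨i, hi, by rw [e]; ext; simp; tauto⟩
  · obtain ⟨i, hi, e⟩ := E_surj3 h z y x h4 h1 hx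
    exact ⟨i, hi, by rw [e]; ext; simp; tauto⟩

/-- A labelling of the vertices. -/
structure Lab (n m : ℕ) (V : Finset ℕ) (H : Finset (Finset ℕ)) (f : ℕ → ℕ) : Prop where
  good : GoodNM n m
  inj : Set.InjOn f (range n : Finset ℕ)
  im : (range n).image f = V
  hH : ThreeGraphOn V H

noncomputable def FE (f : ℕ → ℕ) (i : ℕ) : Finset ℕ := (E i).image f
noncomputable def idx (f : ℕ → ℕ) (m : ℕ) (H : Finset (Finset ℕ)) : Finset ℕ :=
  (range m).filter (fun i => FE f i ∈ H)

section lab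
variable {n m : ℕ} {V : Finset ℕ} {H : Finset (Finset ℕ)} {f : ℕ → ℕ}

theorem Lab.mem (L : Lab n m V H f) {v i : ℕ} (hv : v < n) (hi : i < m) : f v ∈ FE f i ↔ v ∈ E i := by
  constructor
  · intro h
    obtain ⟨w, hw, e⟩ := mem_image.1 h
    have : w = v := L.inj (by simpa using E_sub L.good i hi hw) (by simpa using hv) e
    exact this ▸ hw
  · exact fun h => mem_image_of_mem f h

theorem Lab.inter (L : Lab n m V H f) {i j : ℕ} (hi : i < m) (hj : j < m) :
    (FE f i ∩ FE f j).card = (E i ∩ E j).card := by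
  have h1 : FE f i ∩ FE f j = (E i ∩ E j).image f := by
    ext v
    constructor
    · intro h
      obtain ⟨h1, h2⟩ := mem_inter.1 h
      obtain ⟨w, hw, rfl⟩ := mem_image.1 h1
      rw [L.mem (by simpa using E_sub L.good i hi hw) hj] at h2
      exact mem_image_of_mem f (mem_inter.2 ⟨hw, h2⟩)
    · intro h
      obtain ⟨w, hw, rfl⟩ := mem_image.1 h
      exact mem_inter.2 ⟨mem_image_of_mem f (mem_inter.1 hw).1, mem_image_of_mem f (mem_inter.1 hw).2⟩
  rw [h1, card_image_of_injOn]
  intro x hx y hy e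
  exact L.inj (E_sub L.good i hi (mem_inter.1 hx).1) (E_sub L.good i hi (mem_inter.1 hy).1) e

theorem Lab.FE_inj (L : Lab n m V H f) {i j : ℕ} (hi : i < m) (hj : j < m) (h : FE f i = FE f j) : i = j := by
  have hle := L.good.le
  apply E_inj i j (by omega) (by omega)
  ext v
  constructor
  · intro hv
    rw [← L.mem (by simpa using E_sub L.good i hi hv) hj, ← h]
    exact mem_image_of_mem f hv
  · intro hv
    rw [← L.mem (by simpa using E_sub L.good j hj hv) hi, h]
    exact mem_image_of_mem f hv

theorem Lab.surj (L : Lab n m V H f) (e : Finset ℕ) (he : e ∈ H) : ∃ i ∈ idx f m H, FE f i = e := by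
  obtain ⟨h1, h2⟩ := L.hH e he
  have h3 : ((range n).filter (fun v => f v ∈ e)).image f = e := by
    ext v
    constructor
    · intro h
      obtain ⟨w, hw, rfl⟩ := mem_image.1 h
      exact (mem_filter.1 hw).2
    · intro h
      have := h1 h
      rw [← L.im] at this
      obtain ⟨w, hw, rfl⟩ := mem_image.1 this
      exact mem_image_of_mem f (mem_filter.2 ⟨hw, h⟩)
  obtain ⟨i, hi, hE⟩ := E_surj' L.good ((range n).filter (fun v => f v ∈ e)) (filter_subset _ _) (by
    rw [← h2, ← card_image_of_injOn (f := f), h3]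
    intro x hx y hy e
    exact L.inj (mem_filter.1 hx).1 (mem_filter.1 hy).1 e)
  have : FE f i = e := by rw [FE, hE, h3]
  exact ⟨i, mem_filter.2 ⟨mem_range.2 hi, by rw [this]; exact he⟩, this⟩

theorem idx_lt {i : ℕ} (h : i ∈ idx f m H) : i < m := mem_range.1 (mem_filter.1 h).1
theorem idx_mem {i : ℕ} (h : i ∈ idx f m H) : FE f i ∈ H := (mem_filter.1 h).2

theorem Lab.card (L : Lab n m V H f) (p : Finset ℕ → Prop) [DecidablePred p] :
    ((idx f m H).filter (fun i => p (FE f i))).card = (H.filter p).card := by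
  apply card_bij (fun i _ => FE f i)
  · intro i hi
    obtain ⟨h1, h2⟩ := mem_filter.1 hi
    exact mem_filter.2 ⟨idx_mem h1, h2⟩
  · intro i hi j hj e
    exact L.FE_inj (idx_lt (mem_filter.1 hi).1) (idx_lt (mem_filter.1 hj).1) e
  · intro e he
    obtain ⟨h1, h2⟩ := mem_filter.1 he
    obtain ⟨i, hi, rfl⟩ := L.surj e h1
    exact ⟨i, mem_filter.2 ⟨hi, h2⟩, rfl⟩

theorem Lab.free (L : Lab n m V H f) (hf : P4Free H) : FreeI (idx f m H) := by
  intro a ha b hb c hc d hd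
  by_contra h
  simp only [Bool.not_eq_false, Bool.and_eq_true, Bool.not_eq_true', q, decide_eq_true_eq, decide_eq_false_iff_not] at h
  obtain ⟨⟨⟨⟨⟨h1, h2⟩, h3⟩, h4⟩, h5⟩, h6⟩ := h
  rw [← L.inter (idx_lt ‹_›) (idx_lt ‹_›)] at h1 h2 h3 h4 h5 h6
  refine hf ⟨_, idx_mem ha, _, idx_mem hb, _, idx_mem hc, _, idx_mem hd, ?_⟩
  exact ⟨card_pos.1 h1, card_pos.1 h2, card_pos.1 h3, card_eq_zero.1 (by omega), card_eq_zero.1 (by omega),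
    card_eq_zero.1 (by omega)⟩

end lab

def Ex (H : Finset (Finset ℕ)) (a b c : ℕ) : Prop :=
  ∀ x ∈ H, ∀ y ∈ H, ∀ z ∈ H, ¬((x ∩ y).card = a ∧ (x ∩ z).card = b ∧ (y ∩ z).card = c)

def ExI (HI : Finset ℕ) (a b c : ℕ) : Prop :=
  ∀ x ∈ HI, ∀ y ∈ HI, ∀ z ∈ HI, ¬((E x ∩ E y).card = a ∧ (E x ∩ E z).card = b ∧ (E y ∩ E z).card = c)

theorem Lab.ex {n m : ℕ} {V : Finset ℕ} {H : Finset (Finset ℕ)} {f : ℕ → ℕ} (L : Lab n m V H f) {a b c : ℕ}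
    (h : Ex H a b c) : ExI (idx f m H) a b c := by
  intro x hx y hy z hz
  rw [← L.inter (idx_lt hx) (idx_lt hy), ← L.inter (idx_lt hx) (idx_lt hz), ← L.inter (idx_lt hy) (idx_lt hz)]
  exact h _ (idx_mem hx) _ (idx_mem hy) _ (idx_mem hz)

theorem k2_0_sound (HI : Finset ℕ) : K2Sound k2_0 HI := fun _ _ _ _ w _ _ => tb_zero w

theorem k2_1_sound (HI : Finset ℕ) (hb : ∀ i ∈ HI, i < 120) (h0 : ExI HI 0 0 0) : K2Sound k2_1 HI := by
  intro x hx y hy w hw _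
  have b1 := hb x hx
  have b2 := hb y hy
  have b3 := hb w hw
  have e := h0 x hx y hy w hw
  simp only [k2_1, tb_cond, tb_land, tb_zero, dis_ent, D_tb, b1, b2, b3, q]
  generalize (E x ∩ E y).card = a at *
  generalize (E x ∩ E w).card = b at *
  generalize (E y ∩ E w).card = c at *
  rcases a with _ | a <;> rcases b with _ | b <;> rcases c with _ | c <;> simp at e ⊢

theorem k2_3_sound (HI : Finset ℕ) (hb : ∀ i ∈ HI, i < 120) (h0 : ExI HI 0 0 0) (h1 : ExI HI 0 0 1) : K2Sound k2_3 HI := by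
  intro x hx y hy w hw _
  have b1 := hb x hx
  have b2 := hb y hy
  have b3 := hb w hw
  have e1 := h0 x hx y hy w hw
  have e2 := h1 x hx y hy w hw
  have e3 := h1 y hy x hx w hw
  have e4 := h1 w hw x hx y hy
  rw [inter_comm (E y) (E x)] at e3
  rw [inter_comm (E w) (E x), inter_comm (E w) (E y)] at e4
  simp only [k2_3, tb_cond, tb_land, tb_lor, tb_zero, dis_ent, one_ent, D_tb, O_tb, b1, b2, b3, q]
  generalize (E x ∩ E y).card = a at *
  generalize (E x ∩ E w).card = b at *
  generalize (E y ∩ E w).card = c at *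
  rcases a with _ | _ | a <;> rcases b with _ | _ | b <;> rcases c with _ | _ | c <;> simp at e1 e2 e3 e4 ⊢

theorem k2_11_sound (HI : Finset ℕ) (hb : ∀ i ∈ HI, i < 120) (h0 : ExI HI 0 0 0) (h1 : ExI HI 0 0 1)
    (h2 : ExI HI 0 1 1) : K2Sound k2_11 HI := by
  intro x hx y hy w hw _
  have b1 := hb x hx
  have b2 := hb y hy
  have b3 := hb w hw
  have e1 := h0 x hx y hy w hw
  have e2 := h1 x hx y hy w hw
  have e3 := h1 y hy x hx w hw
  have e4 := h1 w hw x hx y hy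
  have e5 := h2 x hx y hy w hw
  have e6 := h2 w hw x hx y hy
  have e7 := h2 w hw y hy x hx
  rw [inter_comm (E y) (E x)] at e3 e7
  rw [inter_comm (E w) (E x), inter_comm (E w) (E y)] at e4 e6 e7
  simp only [k2_11, tb_cond, tb_land, tb_lor, tb_zero, dis_ent, one_ent, D_tb, O_tb, b1, b2, b3, q]
  generalize (E x ∩ E y).card = a at *
  generalize (E x ∩ E w).card = b at *
  generalize (E y ∩ E w).card = c at *
  rcases a with _ | _ | a <;> rcases b with _ | _ | b <;> rcases c with _ | _ | c <;>
    simp at e1 e2 e3 e4 e5 e6 e7 ⊢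

theorem k2_99_sound (HI : Finset ℕ) (hb : ∀ i ∈ HI, i < 120) (h : ∀ x ∈ HI, ∀ y ∈ HI, 0 < (E x ∩ E y).card) :
    K2Sound k2_99 HI := by
  intro x hx y hy w hw _
  have b1 := hb x hx
  have b2 := hb y hy
  have b3 := hb w hw
  simp only [k2_99, tb_lor, D_tb, b1, b2, b3, q, h x hx w hw, h y hy w hw]
  rfl

def Big (n : ℕ) (V : Finset ℕ) (H : Finset (Finset ℕ)) : Prop :=
  4 * n - 10 ≤ H.card ∧ ∀ v ∈ V, 5 ≤ (H.filter (fun e => v ∉ e)).card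

theorem Lab.card_full {n m : ℕ} {V : Finset ℕ} {H : Finset (Finset ℕ)} {f : ℕ → ℕ} (L : Lab n m V H f) :
    ((idx f m H).filter (fun j => tb (full m) j = true)).card = H.card := by
  have := L.card (fun _ => True)
  rw [filter_true_of_mem (fun i hi => trivial), filter_true_of_mem (fun i hi => trivial)] at this
  rw [filter_true_of_mem (fun i hi => (L.good.full_tb i (idx_lt hi)).2), this]

theorem Lab.main {n m : ℕ} {V : Finset ℕ} {H : Finset (Finset ℕ)} {f : ℕ → ℕ} (L : Lab n m V H f)
    (hB : Big n V H) (hf : P4Free H) {k2 : Ent → Ent → ℕ} {roots : List ℕ} (hR : Res n m k2 roots)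
    (h2 : K2Sound k2 (idx f m H)) (hr : ∀ r ∈ roots, r < m ∧ FE f r ∈ H) : False := by
  obtain ⟨cs, ord, hc, hc', hnd, hk⟩ := hR
  obtain ⟨c, hcs, hlt⟩ := chk_sound hk hc hnd L.good.full_tb (fun i hi => idx_lt hi) (L.free hf) h2
    (fun r hr' => mem_filter.2 ⟨mem_range.2 (hr r hr').1, (hr r hr').2⟩)
  rcases hc' c hcs with rfl | ⟨v, hv, rfl⟩
  · rw [L.card_full] at hlt
    exact absurd hlt (not_lt.2 hB.1)
  · have h3 := hB.2 (f v) (by rw [← L.im]; exact mem_image_of_mem f (mem_range.2 hv))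
    have h4 : ((idx f m H).filter (fun j => tb (avoid m v) j = true)).card = (H.filter (fun e => f v ∉ e)).card := by
      rw [← L.card]
      congr 1
      apply filter_congr
      intro i hi
      have := L.good.full_tb i (idx_lt hi)
      have h10 := L.good.le10
      rw [L.mem hv (idx_lt hi), avoid, tb_land, tb_xor, this.2, full_tb i this.1, stm_tb v (by omega) i this.1]
      by_cases h : v ∈ E i <;> simp [h]
    rw [h4] at hlt
    exact absurd hlt (not_lt.2 h3)

theorem exists_lab {n m : ℕ} {V : Finset ℕ} {H : Finset (Finset ℕ)} (hg : GoodNM n m) (hV : V.card = n)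
    (hH : ThreeGraphOn V H) (p : List ℕ) (hp : p.Nodup) (hpV : ∀ v ∈ p, v ∈ V) :
    ∃ rest : List ℕ, Lab n m V H (fun k => (p ++ rest).getD k 0) := by
  refine ⟨(V \ p.toFinset).toList, hg, ?_, ?_, hH⟩
  all_goals
    have hnd : (p ++ (V \ p.toFinset).toList).Nodup := by
      refine List.Nodup.append hp (nodup_toList _) ?_
      intro v hv hv'
      simp at hv'
      exact hv'.2 hv
    have hset : (p ++ (V \ p.toFinset).toList).toFinset = V := by
      ext v
      simp only [List.toFinset_append, mem_union, List.mem_toFinset, mem_toList, mem_sdiff]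
      constructor
      · rintro (h | h)
        · exact hpV v h
        · exact h.1
      · intro h
        by_cases h' : v ∈ p
        · exact Or.inl h'
        · exact Or.inr ⟨h, h'⟩
    have hlen : (p ++ (V \ p.toFinset).toList).length = n := by
      rw [← List.toFinset_card_of_nodup hnd, hset, hV]
    generalize p ++ (V \ p.toFinset).toList = l at *
  · intro x hx y hy e
    have hx' : x < l.length := by simpa [hlen] using hx
    have hy' : y < l.length := by simpa [hlen] using hy
    simp only [List.getD_eq_getElem _ _ hx', List.getD_eq_getElem _ _ hy'] at e
    exact (List.Nodup.getElem_inj_iff hnd).1 e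
  · ext v
    rw [← hset, List.mem_toFinset, List.mem_iff_getElem, mem_image]
    constructor
    · rintro ⟨k, hk, rfl⟩
      have hk' : k < l.length := by simpa [hlen] using hk
      exact ⟨k, hk', (List.getD_eq_getElem _ _ hk').symm⟩
    · rintro ⟨k, hk, rfl⟩
      exact ⟨k, by simpa [hlen] using hk, List.getD_eq_getElem _ _ hk⟩

theorem split0 {x z : Finset ℕ} (hx : x.card = 3) (h : (x ∩ z).card = 0) :
    ∃ a b c, x = {a, b, c} ∧ a ∉ z ∧ b ∉ z ∧ c ∉ z ∧ a ≠ b ∧ a ≠ c ∧ b ≠ c := by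
  obtain ⟨a, b, c, h1, h2, h3, rfl⟩ := card_eq_three.1 hx
  rw [card_eq_zero] at h
  have h' : ∀ v ∈ ({a, b, c} : Finset ℕ), v ∉ z := fun v hv hz => by
    have := mem_inter.2 ⟨hv, hz⟩
    rw [h] at this; exact absurd this (notMem_empty v)
  exact ⟨a, b, c, rfl, h' a (by simp), h' b (by simp), h' c (by simp), h1, h2, h3⟩

theorem split1 {x z : Finset ℕ} (hx : x.card = 3) (h : (x ∩ z).card = 1) :
    ∃ a b c, x = {a, b, c} ∧ a ∈ z ∧ b ∉ z ∧ c ∉ z ∧ a ≠ b ∧ a ≠ c ∧ b ≠ c := by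
  have h2 : (x \ z).card = 2 := by have := card_sdiff_add_card_inter x z; omega
  obtain ⟨a, ha⟩ := card_eq_one.1 h
  obtain ⟨b, c, hbc, hb⟩ := card_eq_two.1 h2
  have ha' : a ∈ x ∩ z := by rw [ha]; simp
  have hb' : b ∈ x \ z := by rw [hb]; simp
  have hc' : c ∈ x \ z := by rw [hb]; simp
  rw [mem_inter] at ha'
  rw [mem_sdiff] at hb' hc'
  refine ⟨a, b, c, ?_, ha'.2, hb'.2, hc'.2, ?_, ?_, hbc⟩
  · rw [← sdiff_union_inter x z, ha, hb]; ext v; simp; tauto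
  · rintro rfl; exact hb'.2 ha'.2
  · rintro rfl; exact hc'.2 ha'.2

theorem split2 {x z : Finset ℕ} (hx : x.card = 3) (h : (x ∩ z).card = 2) :
    ∃ a b c, x = {a, b, c} ∧ a ∈ z ∧ b ∈ z ∧ c ∉ z ∧ a ≠ b ∧ a ≠ c ∧ b ≠ c := by
  have h2 : (x \ z).card = 1 := by have := card_sdiff_add_card_inter x z; omega
  obtain ⟨c, hc⟩ := card_eq_one.1 h2
  obtain ⟨a, b, hab, hb⟩ := card_eq_two.1 h
  have ha' : a ∈ x ∩ z := by rw [hb]; simp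
  have hb' : b ∈ x ∩ z := by rw [hb]; simp
  have hc' : c ∈ x \ z := by rw [hc]; simp
  rw [mem_inter] at ha' hb'
  rw [mem_sdiff] at hc'
  refine ⟨a, b, c, ?_, ha'.2, hb'.2, hc'.2, hab, ?_, ?_⟩
  · rw [← sdiff_union_inter x z, hc, hb]; ext v; simp; tauto
  · rintro rfl; exact hc'.2 ha'.2
  · rintro rfl; exact hc'.2 hb'.2

theorem ext1 {z : Finset ℕ} (hz : z.card = 3) {p : ℕ} (hp : p ∈ z) :
    ∃ s t, z = {p, s, t} ∧ p ≠ s ∧ p ≠ t ∧ s ≠ t := by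
  obtain ⟨s, t, hst, h⟩ := card_eq_two.1 (show (z.erase p).card = 2 by rw [card_erase_of_mem hp]; omega)
  have h1 : s ∈ z.erase p := by rw [h]; simp
  have h2 : t ∈ z.erase p := by rw [h]; simp
  exact ⟨s, t, by rw [← insert_erase hp, h], (ne_of_mem_erase h1).symm, (ne_of_mem_erase h2).symm, hst⟩

theorem ext2 {z : Finset ℕ} (hz : z.card = 3) {p r : ℕ} (hp : p ∈ z) (hr : r ∈ z) (hpr : p ≠ r) :
    ∃ s, z = {p, r, s} ∧ p ≠ s ∧ r ≠ s := by
  obtain ⟨s, t, rfl, h1, h2, h3⟩ := ext1 hz hp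
  simp only [mem_insert, mem_singleton] at hr
  rcases hr with rfl | rfl | rfl
  · exact absurd rfl hpr
  · exact ⟨t, rfl, h2, h3⟩
  · exact ⟨s, by ext; simp; tauto, h1, h3.symm⟩

theorem ext3 {z : Finset ℕ} (hz : z.card = 3) {p r s : ℕ} (hp : p ∈ z) (hr : r ∈ z) (hs : s ∈ z) (hpr : p ≠ r)
    (hps : p ≠ s) (hrs : r ≠ s) : z = {p, r, s} := by
  obtain ⟨t, rfl, h1, h2⟩ := ext2 hz hp hr hpr
  simp only [mem_insert, mem_singleton] at hs
  rcases hs with rfl | rfl | rfl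
  · exact absurd rfl hps
  · exact absurd rfl hrs
  · rfl

theorem dj {x y : Finset ℕ} (h : (x ∩ y).card = 0) : ∀ v ∈ x, v ∉ y := fun v hv hz => by
  have := mem_inter.2 ⟨hv, hz⟩
  rw [card_eq_zero.1 h] at this; exact absurd this (notMem_empty v)

theorem E_vals : E 0 = {0, 1, 2} ∧ E 19 = {3, 4, 5} ∧ E 83 = {6, 7, 8} ∧ E 50 = {0, 6, 7} ∧ E 23 = {0, 3, 6} ∧
    E 20 = {0, 1, 6} ∧ E 1 = {0, 1, 3} ∧ E 7 = {0, 3, 4} ∧ E 3 = {1, 2, 3} ∧ E 34 = {4, 5, 6} ∧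
    E 17 = {1, 4, 5} ∧ E 6 = {1, 2, 4} := by decide +kernel

section pats
variable {n m : ℕ} {V : Finset ℕ} {H : Finset (Finset ℕ)}

theorem ex00 (hg : GoodNM n m) (hV : V.card = n) (hH : ThreeGraphOn V H) (hf : P4Free H) (hB : Big n V H) :
    Ex H 0 0 0 := by
  rintro x hx y hy z hz ⟨h1, h2, h3⟩
  have hm : 84 ≤ m := by rcases hg with ⟨_, h⟩ | ⟨_, h⟩ <;> omega
  have dxy := dj h1
  have dxz := dj h2
  have dyz := dj h3
  have sx := (hH x hx).1
  have sy := (hH y hy).1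
  have sz := (hH z hz).1
  obtain ⟨a, b, c, rfl, -, -, -, n1, n2, n3⟩ := split0 (hH x hx).2 h1
  obtain ⟨d, e, g, rfl, -, -, -, n4, n5, n6⟩ := split0 (hH y hy).2 h3
  obtain ⟨i, j, k, n7, n8, n9, rfl⟩ := card_eq_three.1 (hH z hz).2
  obtain ⟨rest, L⟩ := exists_lab hg hV hH [a, b, c, d, e, g, i, j, k]
    (by simp at dxy dxz dyz ⊢; grind) (by simp [insert_subset_iff] at sx sy sz ⊢; tauto)
  refine L.main hB hf (res00 n m hg) (k2_0_sound _) ?_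
  simp only [List.forall_mem_cons, FE, E_vals, image_insert, image_singleton]
  exact ⟨⟨by omega, hx⟩, ⟨by omega, hy⟩, ⟨by omega, hz⟩, by simp⟩

theorem ex01 (hg : GoodNM n m) (hV : V.card = n) (hH : ThreeGraphOn V H) (hf : P4Free H) (hB : Big n V H) :
    Ex H 0 0 1 := by
  have t00 := ex00 hg hV hH hf hB
  rintro y hy x hx z hz ⟨h1, h2, h3⟩
  have hm : 84 ≤ m := by rcases hg with ⟨_, h⟩ | ⟨_, h⟩ <;> omega
  have dxy := dj h1
  have dyz := dj h2
  have sx := (hH x hx).1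
  have sy := (hH y hy).1
  have sz := (hH z hz).1
  obtain ⟨a, b, c, rfl, m1, m2, m3, n1, n2, n3⟩ := split1 (hH x hx).2 h3
  obtain ⟨d, e, g, rfl, -, -, -, n4, n5, n6⟩ := split0 (hH y hy).2 h1
  obtain ⟨i, j, rfl, n7, n8, n9⟩ := ext1 (hH z hz).2 m1
  obtain ⟨rest, L⟩ := exists_lab hg hV hH [a, b, c, d, e, g, i, j]
    (by simp at dxy dyz m1 m2 m3 ⊢; grind) (by simp [insert_subset_iff] at sx sy sz ⊢; tauto)
  refine L.main hB hf (res01 n m hg) (k2_1_sound _ (fun i hi => (hg.full_tb i (idx_lt hi)).1) (L.ex t00)) ?_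
  simp only [List.forall_mem_cons, FE, E_vals, image_insert, image_singleton]
  exact ⟨⟨by omega, hx⟩, ⟨by omega, hy⟩, ⟨by omega, hz⟩, by simp⟩

theorem ex11 (hg : GoodNM n m) (hV : V.card = n) (hH : ThreeGraphOn V H) (hf : P4Free H) (hB : Big n V H) :
    Ex H 0 1 1 := by
  have t00 := ex00 hg hV hH hf hB
  have t01 := ex01 hg hV hH hf hB
  rintro x hx y hy z hz ⟨h1, h2, h3⟩
  have hm : 84 ≤ m := by rcases hg with ⟨_, h⟩ | ⟨_, h⟩ <;> omega
  have dxy := dj h1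
  have sx := (hH x hx).1
  have sy := (hH y hy).1
  have sz := (hH z hz).1
  obtain ⟨a, b, c, rfl, m1, m2, m3, n1, n2, n3⟩ := split1 (hH x hx).2 h2
  obtain ⟨d, e, g, rfl, m4, m5, m6, n4, n5, n6⟩ := split1 (hH y hy).2 h3
  obtain ⟨i, rfl, n7, n8⟩ := ext2 (hH z hz).2 m1 m4 (by simp at dxy; tauto)
  obtain ⟨rest, L⟩ := exists_lab hg hV hH [a, b, c, d, e, g, i]
    (by simp at dxy m1 m2 m3 m4 m5 m6 ⊢; grind) (by simp [insert_subset_iff] at sx sy sz ⊢; tauto)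
  refine L.main hB hf (res11 n m hg)
    (k2_3_sound _ (fun i hi => (hg.full_tb i (idx_lt hi)).1) (L.ex t00) (L.ex t01)) ?_
  simp only [List.forall_mem_cons, FE, E_vals, image_insert, image_singleton]
  exact ⟨⟨by omega, hx⟩, ⟨by omega, hy⟩, ⟨by omega, hz⟩, by simp⟩

theorem ex02 (hg : GoodNM n m) (hV : V.card = n) (hH : ThreeGraphOn V H) (hf : P4Free H) (hB : Big n V H) :
    Ex H 0 0 2 := by
  have t00 := ex00 hg hV hH hf hB
  have t01 := ex01 hg hV hH hf hB
  have t11 := ex11 hg hV hH hf hB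
  rintro y hy x hx z hz ⟨h1, h2, h3⟩
  have hm : 84 ≤ m := by rcases hg with ⟨_, h⟩ | ⟨_, h⟩ <;> omega
  have dxy := dj h1
  have dyz := dj h2
  have sx := (hH x hx).1
  have sy := (hH y hy).1
  have sz := (hH z hz).1
  obtain ⟨a, b, c, rfl, m1, m2, m3, n1, n2, n3⟩ := split2 (hH x hx).2 h3
  obtain ⟨d, e, g, rfl, -, -, -, n4, n5, n6⟩ := split0 (hH y hy).2 h1
  obtain ⟨i, rfl, n7, n8⟩ := ext2 (hH z hz).2 m1 m2 n1
  obtain ⟨rest, L⟩ := exists_lab hg hV hH [a, b, c, d, e, g, i]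
    (by simp at dxy dyz m1 m2 m3 ⊢; grind) (by simp [insert_subset_iff] at sx sy sz ⊢; tauto)
  refine L.main hB hf (res02 n m hg)
    (k2_11_sound _ (fun i hi => (hg.full_tb i (idx_lt hi)).1) (L.ex t00) (L.ex t01) (L.ex t11)) ?_
  simp only [List.forall_mem_cons, FE, E_vals, image_insert, image_singleton]
  exact ⟨⟨by omega, hx⟩, ⟨by omega, hy⟩, ⟨by omega, hz⟩, by simp⟩

theorem ex12 (hg : GoodNM n m) (hV : V.card = n) (hH : ThreeGraphOn V H) (hf : P4Free H) (hB : Big n V H) :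
    Ex H 0 1 2 := by
  have t00 := ex00 hg hV hH hf hB
  have t01 := ex01 hg hV hH hf hB
  have t11 := ex11 hg hV hH hf hB
  rintro y hy x hx z hz ⟨h1, h2, h3⟩
  have hm : 84 ≤ m := by rcases hg with ⟨_, h⟩ | ⟨_, h⟩ <;> omega
  have dxy := dj h1
  have sx := (hH x hx).1
  have sy := (hH y hy).1
  have sz := (hH z hz).1
  obtain ⟨a, b, c, rfl, m1, m2, m3, n1, n2, n3⟩ := split2 (hH x hx).2 h3
  obtain ⟨d, e, g, rfl, m4, m5, m6, n4, n5, n6⟩ := split1 (hH y hy).2 h2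
  obtain rfl := ext3 (hH z hz).2 m1 m2 m4 n1 (by simp at dxy; grind) (by simp at dxy; grind)
  obtain ⟨rest, L⟩ := exists_lab hg hV hH [a, b, c, d, e, g]
    (by simp at dxy m1 m2 m3 m4 m5 m6 ⊢; grind) (by simp [insert_subset_iff] at sx sy sz ⊢; tauto)
  refine L.main hB hf (res12 n m hg)
    (k2_11_sound _ (fun i hi => (hg.full_tb i (idx_lt hi)).1) (L.ex t00) (L.ex t01) (L.ex t11)) ?_
  simp only [List.forall_mem_cons, FE, E_vals, image_insert, image_singleton]
  exact ⟨⟨by omega, hx⟩, ⟨by omega, hy⟩, ⟨by omega, hz⟩, by simp⟩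

theorem exI2 (hg : GoodNM n m) (hV : V.card = n) (hH : ThreeGraphOn V H) (hf : P4Free H) (hB : Big n V H)
    (hI : ∀ x ∈ H, ∀ y ∈ H, 0 < (x ∩ y).card) (x y : Finset ℕ) (hx : x ∈ H) (hy : y ∈ H) : (x ∩ y).card ≠ 2 := by
  intro h
  have hm : 84 ≤ m := by rcases hg with ⟨_, h⟩ | ⟨_, h⟩ <;> omega
  have sx := (hH x hx).1
  have sy := (hH y hy).1
  obtain ⟨a, b, c, rfl, m1, m2, m3, n1, n2, n3⟩ := split2 (hH x hx).2 h
  obtain ⟨d, rfl, n4, n5⟩ := ext2 (hH y hy).2 m1 m2 n1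
  obtain ⟨rest, L⟩ := exists_lab hg hV hH [a, b, c, d]
    (by simp at m1 m2 m3 ⊢; grind) (by simp [insert_subset_iff] at sx sy ⊢; tauto)
  refine L.main hB hf (resI2 n m hg)
    (k2_99_sound _ (fun i hi => (hg.full_tb i (idx_lt hi)).1) ?_) ?_
  · intro x hx y hy
    rw [← L.inter (idx_lt hx) (idx_lt hy)]
    exact hI _ (idx_mem hx) _ (idx_mem hy)
  simp only [List.forall_mem_cons, FE, E_vals, image_insert, image_singleton]
  exact ⟨⟨by omega, hx⟩, ⟨by omega, hy⟩, by simp⟩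

theorem exI1 (hg : GoodNM n m) (hV : V.card = n) (hH : ThreeGraphOn V H) (hf : P4Free H) (hB : Big n V H)
    (hI : ∀ x ∈ H, ∀ y ∈ H, 0 < (x ∩ y).card) (x y : Finset ℕ) (hx : x ∈ H) (hy : y ∈ H) : (x ∩ y).card ≠ 1 := by
  intro h
  have hm : 84 ≤ m := by rcases hg with ⟨_, h⟩ | ⟨_, h⟩ <;> omega
  have sx := (hH x hx).1
  have sy := (hH y hy).1
  obtain ⟨a, b, c, rfl, m1, m2, m3, n1, n2, n3⟩ := split1 (hH x hx).2 h
  obtain ⟨d, e, rfl, n4, n5, n6⟩ := ext1 (hH y hy).2 m1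
  obtain ⟨rest, L⟩ := exists_lab hg hV hH [a, b, c, d, e]
    (by simp at m1 m2 m3 ⊢; grind) (by simp [insert_subset_iff] at sx sy ⊢; tauto)
  refine L.main hB hf (resI1 n m hg)
    (k2_99_sound _ (fun i hi => (hg.full_tb i (idx_lt hi)).1) ?_) ?_
  · intro x hx y hy
    rw [← L.inter (idx_lt hx) (idx_lt hy)]
    exact hI _ (idx_mem hx) _ (idx_mem hy)
  simp only [List.forall_mem_cons, FE, E_vals, image_insert, image_singleton]
  exact ⟨⟨by omega, hx⟩, ⟨by omega, hy⟩, by simp⟩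

theorem inter_lt {x y : Finset ℕ} (hx : x.card = 3) (hy : y.card = 3) (h : x ≠ y) : (x ∩ y).card ≤ 2 := by
  by_contra hc
  apply h
  have h1 : x ∩ y = x := eq_of_subset_of_card_le inter_subset_left (by omega)
  have h2 : x ∩ y = y := eq_of_subset_of_card_le inter_subset_right (by omega)
  rw [← h1, h2]

theorem not_big (hg : GoodNM n m) (hV : V.card = n) (hH : ThreeGraphOn V H) (hf : P4Free H) : ¬ Big n V H := by
  intro hB
  have hle := hg.le10
  have hcard : 3 ≤ H.card := by have := hB.1; omega
  have hI : ∀ x ∈ H, ∀ y ∈ H, 0 < (x ∩ y).card := by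
    intro x hx y hy
    by_contra h0
    have h0 : (x ∩ y).card = 0 := by omega
    obtain ⟨z, hz, hzn⟩ : ∃ z ∈ H, z ∉ ({x, y} : Finset (Finset ℕ)) := by
      by_contra hc
      push Not at hc
      have := card_le_card (show H ⊆ {x, y} from hc)
      have := card_le_two (a := x) (b := y)
      omega
    simp only [mem_insert, mem_singleton, not_or] at hzn
    have c1 := inter_lt (hH x hx).2 (hH z hz).2 (Ne.symm hzn.1)
    have c2 := inter_lt (hH y hy).2 (hH z hz).2 (Ne.symm hzn.2)
    have c3 : (x ∩ z).card + (y ∩ z).card ≤ 3 := by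
      rw [← card_union_of_disjoint, ← (hH z hz).2]
      · exact card_le_card (union_subset inter_subset_right inter_subset_right)
      · rw [disjoint_left]
        intro v hv hv'
        exact dj h0 v (mem_inter.1 hv).1 (mem_inter.1 hv').1
    have h0' : (y ∩ x).card = 0 := by rw [inter_comm]; exact h0
    have a1 := ex00 hg hV hH hf hB x hx y hy z hz
    have a2 := ex01 hg hV hH hf hB x hx y hy z hz
    have a3 := ex01 hg hV hH hf hB y hy x hx z hz
    have a4 := ex11 hg hV hH hf hB x hx y hy z hz
    have a5 := ex02 hg hV hH hf hB x hx y hy z hz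
    have a6 := ex02 hg hV hH hf hB y hy x hx z hz
    have a7 := ex12 hg hV hH hf hB x hx y hy z hz
    have a8 := ex12 hg hV hH hf hB y hy x hx z hz
    omega
  obtain ⟨x, hx, y, hy, hxy⟩ := one_lt_card.1 (show 1 < H.card by omega)
  have := inter_lt (hH x hx).2 (hH y hy).2 hxy
  have := hI x hx y hy
  have := exI1 hg hV hH hf hB hI x y hx hy
  have := exI2 hg hV hH hf hB hI x y hx hy
  omega

end pats

theorem xSP_sem84 : ∀ j < 84, tb (xSP 84) j = false →
    E j = {1, 2, 3} ∨ E j = {1, 4, 5} ∨ (0 ∈ E j ∧ ∃ v ∈ E j, v ∈ ({1, 2, 3, 1, 4, 5} : Finset ℕ)) := by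
  decide +kernel
theorem xSP_sem120 : ∀ j < 120, tb (xSP 120) j = false →
    E j = {1, 2, 3} ∨ E j = {1, 4, 5} ∨ (0 ∈ E j ∧ ∃ v ∈ E j, v ∈ ({1, 2, 3, 1, 4, 5} : Finset ℕ)) := by
  decide +kernel
theorem xSK_sem84 : ∀ j < 84, tb (xSK 84) j = false →
    E j ⊆ {1, 2, 3, 4} ∨ (0 ∈ E j ∧ ∃ v ∈ E j, v ∈ ({1, 2, 3, 4} : Finset ℕ)) := by
  decide +kernel
theorem xSK_sem120 : ∀ j < 120, tb (xSK 120) j = false →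
    E j ⊆ {1, 2, 3, 4} ∨ (0 ∈ E j ∧ ∃ v ∈ E j, v ∈ ({1, 2, 3, 4} : Finset ℕ)) := by
  decide +kernel

section lemA
variable {n m : ℕ} {V : Finset ℕ} {H : Finset (Finset ℕ)} {f : ℕ → ℕ}

theorem Lab.mainA (L : Lab n m V H f)
    (hB : 4 * n - 10 ≤ H.card) (hS : 4 * n - 10 - 4 ≤ (H.filter (fun e => f 0 ∈ e)).card)
    (hf : P4Free H) {X : List (ℕ × ℕ)} {roots : List ℕ} (hR : ResA n m X roots)
    (hr : ∀ r ∈ roots, r < m ∧ FE f r ∈ H) :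
    ∃ c ∈ X, ((idx f m H).filter (fun j => tb c.1 j = true)).card < c.2 := by
  obtain ⟨ord, hc, hnd, hk⟩ := hR
  obtain ⟨c, hcs, hlt⟩ := chk_sound hk hc hnd L.good.full_tb (fun i hi => idx_lt hi) (L.free hf) (k2_0_sound _)
    (fun r hr' => mem_filter.2 ⟨mem_range.2 (hr r hr').1, (hr r hr').2⟩)
  rw [condsA, List.mem_cons, List.mem_cons] at hcs
  rcases hcs with rfl | rfl | hcs
  · rw [L.card_full] at hlt
    exact absurd hlt (not_lt.2 hB)
  · have h4 : ((idx f m H).filter (fun j => tb (Nat.land (full m) (stm 0)) j = true)).card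
        = (H.filter (fun e => f 0 ∈ e)).card := by
      rw [← L.card]
      congr 1
      apply filter_congr
      intro i hi
      have := L.good.full_tb i (idx_lt hi)
      have h10 := L.good.le10
      rw [L.mem (by omega) (idx_lt hi), tb_land, this.2, stm_tb 0 (by omega) i this.1]
      simp
    rw [h4] at hlt
    exact absurd hlt (not_lt.2 hS)
  · exact ⟨c, hcs, hlt⟩

theorem Lab.mainA' (L : Lab n m V H f)
    (hB : 4 * n - 10 ≤ H.card) (hS : 4 * n - 10 - 4 ≤ (H.filter (fun e => f 0 ∈ e)).card)
    (hf : P4Free H) {X : ℕ} {roots : List ℕ} (hR : ResA n m [(X, 1)] roots)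
    (hr : ∀ r ∈ roots, r < m ∧ FE f r ∈ H) (e : Finset ℕ) (he : e ∈ H) :
    ∃ j < m, tb X j = false ∧ FE f j = e := by
  obtain ⟨c, hc, hlt⟩ := L.mainA hB hS hf hR hr
  rw [List.mem_singleton] at hc
  subst hc
  obtain ⟨j, hj, rfl⟩ := L.surj e he
  refine ⟨j, idx_lt hj, ?_, rfl⟩
  by_contra h
  have hmem : j ∈ (idx f m H).filter (fun j => tb X j = true) := mem_filter.2 ⟨hj, by simpa using h⟩
  have hp := card_pos.2 ⟨j, hmem⟩
  have hlt' : ((idx f m H).filter (fun j => tb X j = true)).card < 1 := hlt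
  omega

/-- cardinality of the `K`-star -/
theorem card_SK (hn : n = 9 ∨ n = 10) (hV : V.card = n) (v : ℕ) (hv : v ∈ V) (A : Finset ℕ) (hA : A ⊆ V)
    (hA4 : A.card = 4) (hvA : v ∉ A) :
    (A.powersetCard 3 ∪ (V.powersetCard 3).filter (fun t => v ∈ t ∧ (t ∩ A).Nonempty)).card = 4 * n - 10 := by
  have h1 : (V.powersetCard 3).filter (fun t => v ∈ t ∧ (t ∩ A).Nonempty) =
      ((V.erase v).powersetCard 2 \ ((V.erase v) \ A).powersetCard 2).image (insert v) := by
    ext t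
    simp only [mem_filter, mem_powersetCard, mem_image, mem_sdiff]
    constructor
    · rintro ⟨⟨h1, h2⟩, h3, w, hw⟩
      rw [mem_inter] at hw
      refine ⟨t.erase v, ⟨⟨erase_subset_erase v h1, by rw [card_erase_of_mem h3]; omega⟩, ?_⟩, insert_erase h3⟩
      rintro ⟨h4, -⟩
      have : w ∈ t.erase v := mem_erase.2 ⟨by rintro rfl; exact hvA hw.2, hw.1⟩
      exact (mem_sdiff.1 (h4 this)).2 hw.2
    · rintro ⟨s, ⟨⟨h1, h2⟩, h3⟩, rfl⟩
      have hvs : v ∉ s := fun h => (mem_erase.1 (h1 h)).1 rfl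
      refine ⟨⟨insert_subset hv (h1.trans (erase_subset v V)), by rw [card_insert_of_notMem hvs, h2]⟩,
        mem_insert_self v s, ?_⟩
      by_contra hne
      apply h3
      refine ⟨fun w hw => mem_sdiff.2 ⟨h1 hw, fun hwA => hne ⟨w, mem_inter.2 ⟨mem_insert_of_mem hw, hwA⟩⟩⟩, h2⟩
  have hAe : A ⊆ V.erase v := fun w hw => mem_erase.2 ⟨by rintro rfl; exact hvA hw, hA hw⟩
  have c1 : (V.erase v).card = n - 1 := by rw [card_erase_of_mem hv, hV]
  rw [card_union_of_disjoint, h1, card_image_of_injOn, card_sdiff_of_subset, card_powersetCard, card_powersetCard,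
    card_powersetCard, card_sdiff_of_subset hAe, c1, hA4]
  · rcases hn with rfl | rfl <;> decide
  · exact powersetCard_mono sdiff_subset
  · intro s hs t ht e
    have hs' : v ∉ s := fun h => (mem_erase.1 ((mem_powersetCard.1 (mem_sdiff.1 hs).1).1 h)).1 rfl
    have ht' : v ∉ t := fun h => (mem_erase.1 ((mem_powersetCard.1 (mem_sdiff.1 ht).1).1 h)).1 rfl
    have e' : insert v s = insert v t := e
    rw [← erase_insert hs', e', erase_insert ht']
  · rw [disjoint_left]
    intro t ht ht'
    exact hvA ((mem_powersetCard.1 ht).1 (mem_filter.1 ht').2.1)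

theorem lemA (hg : GoodNM n m) (hn : n = 9 ∨ n = 10) (hV : V.card = n) (hH : ThreeGraphOn V H) (hf : P4Free H)
    (hB : 4 * n - 10 ≤ H.card) (v : ℕ) (hv : v ∈ V) (hv4 : (H.filter (fun e => v ∉ e)).card ≤ 4) :
    SubStarPlus V H ∨ SubSP V H ∨ (IsSKOn V H ∧ H.card = 4 * n - 10) := by
  have hm : 84 ≤ m := by rcases hg with ⟨_, h⟩ | ⟨_, h⟩ <;> omega
  have hle := hg.le10
  have hS : 4 * n - 10 - 4 ≤ (H.filter (fun e => v ∈ e)).card := by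
    have := card_filter_add_card_filter_not (s := H) (fun e => v ∈ e)
    omega
  by_cases h1 : (H.filter (fun e => v ∉ e)).card ≤ 1
  · left
    obtain ⟨e, he, he3, hve, hsub⟩ : ∃ e : Finset ℕ, e ⊆ V ∧ e.card = 3 ∧ v ∉ e ∧ H.filter (fun e => v ∉ e) ⊆ {e} := by
      rcases Nat.le_one_iff_eq_zero_or_eq_one.1 h1 with h | h
      · obtain ⟨e, he, h3⟩ := exists_subset_card_eq (s := V.erase v) (n := 3) (by
          rw [card_erase_of_mem hv]; omega)
        refine ⟨e, he.trans (erase_subset v V), h3, fun h => (mem_erase.1 (he h)).1 rfl, ?_⟩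
        rw [card_eq_zero.1 h]; simp
      · obtain ⟨e, he⟩ := card_eq_one.1 h
        have hm : e ∈ H.filter (fun e => v ∉ e) := by rw [he]; simp
        rw [mem_filter] at hm
        exact ⟨e, (hH e hm.1).1, (hH e hm.1).2, hm.2, by rw [he]⟩
    refine ⟨_, ⟨v, hv, e, he, he3, hve, rfl⟩, ?_⟩
    intro t ht
    by_cases hvt : v ∈ t
    · exact mem_union_left _ (mem_filter.2 ⟨mem_powersetCard.2 (hH t ht), hvt⟩)
    · exact mem_union_right _ (hsub (mem_filter.2 ⟨ht, hvt⟩))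
  · obtain ⟨x, hx, y, hy, hxy⟩ := one_lt_card.1 (not_le.1 h1)
    rw [mem_filter] at hx hy
    obtain ⟨hx, hvx⟩ := hx
    obtain ⟨hy, hvy⟩ := hy
    have hlt := inter_lt (hH x hx).2 (hH y hy).2 hxy
    have sx := (hH x hx).1
    have sy := (hH y hy).1
    obtain h | h | h : (x ∩ y).card = 0 ∨ (x ∩ y).card = 1 ∨ (x ∩ y).card = 2 := by omega
    · exfalso
      have dxy := dj h
      obtain ⟨a, b, c, rfl, -, -, -, n1, n2, n3⟩ := split0 (hH x hx).2 h
      obtain ⟨d, e, g, n4, n5, n6, rfl⟩ := card_eq_three.1 (hH y hy).2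
      obtain ⟨rest, L⟩ := exists_lab hg hV hH [v, a, b, c, d, e, g]
        (by simp at dxy hvx hvy ⊢; grind) (by simp [insert_subset_iff] at sx sy ⊢; tauto)
      obtain ⟨c, hc, -⟩ := L.mainA hB hS hf (resA0 n m hg) (by
        simp only [List.forall_mem_cons, FE, E_vals, image_insert, image_singleton]
        exact ⟨⟨by omega, hx⟩, ⟨by omega, hy⟩, by simp⟩)
      simp at hc
    · right; left
      have h' := h
      have cx := (hH x hx).2
      have cy := (hH y hy).2
      obtain ⟨a, b, c, rfl, m1, m2, m3, n1, n2, n3⟩ := split1 (hH x hx).2 h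
      obtain ⟨d, e, rfl, n4, n5, n6⟩ := ext1 (hH y hy).2 m1
      obtain ⟨rest, L⟩ := exists_lab hg hV hH [v, a, b, c, d, e]
        (by simp at m1 m2 m3 hvx hvy ⊢; grind) (by simp [insert_subset_iff] at sx sy ⊢; tauto)
      refine ⟨_, ⟨v, hv, {a, b, c}, {a, d, e}, sx, sy, cx, cy, h', by simp only [mem_union]; tauto, rfl⟩, ?_⟩
      intro t ht
      obtain ⟨j, hj, hX, hjt⟩ := L.mainA' hB hS hf (resA1 n m hg) (by
        simp only [List.forall_mem_cons, FE, E_vals, image_insert, image_singleton]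
        exact ⟨⟨by omega, hx⟩, ⟨by omega, hy⟩, by simp⟩) t ht
      have hsem : E j = {1, 2, 3} ∨ E j = {1, 4, 5} ∨ (0 ∈ E j ∧ ∃ v ∈ E j, v ∈ ({1, 2, 3, 1, 4, 5} : Finset ℕ)) := by
        rcases hg with ⟨rfl, rfl⟩ | ⟨rfl, rfl⟩
        · exact xSP_sem84 j hj hX
        · exact xSP_sem120 j hj hX
      rcases hsem with hE | hE | ⟨h0, w, hw, hw'⟩
      · rw [FE, hE, image_insert, image_insert, image_singleton] at hjt
        have hjt' : {a, b, c} = t := hjt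
        rw [← hjt']; simp
      · rw [FE, hE, image_insert, image_insert, image_singleton] at hjt
        have hjt' : {a, d, e} = t := hjt
        rw [← hjt']; simp
      · apply mem_union_right
        refine mem_filter.2 ⟨mem_powersetCard.2 (hH t ht), ?_, ?_⟩
        · rw [← hjt]; exact mem_image_of_mem _ h0
        · refine ⟨_, mem_inter.2 ⟨by rw [← hjt]; exact mem_image_of_mem _ hw, ?_⟩⟩
          simp only [mem_insert, mem_singleton] at hw'
          rcases hw' with rfl | rfl | rfl | rfl | rfl | rfl <;> simp
    · right; right
      obtain ⟨a, b, c, rfl, m1, m2, m3, n1, n2, n3⟩ := split2 (hH x hx).2 h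
      obtain ⟨d, rfl, n4, n5⟩ := ext2 (hH y hy).2 m1 m2 n1
      obtain ⟨rest, L⟩ := exists_lab hg hV hH [v, a, b, c, d]
        (by simp at m1 m2 m3 hvx hvy ⊢; grind) (by simp [insert_subset_iff] at sx sy ⊢; tauto)
      have hAV : ({a, b, c, d} : Finset ℕ) ⊆ V := by simp [insert_subset_iff] at sx sy ⊢; tauto
      have hA4 : ({a, b, c, d} : Finset ℕ).card = 4 := by
        simp at m3
        rw [card_insert_of_notMem (by simp; tauto), card_insert_of_notMem (by simp; tauto),
          card_insert_of_notMem (by simp; tauto), card_singleton]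
      have hvA : v ∉ ({a, b, c, d} : Finset ℕ) := by simp at hvx hvy ⊢; tauto
      have hsub : H ⊆ ({a, b, c, d} : Finset ℕ).powersetCard 3 ∪
          (V.powersetCard 3).filter (fun t => v ∈ t ∧ (t ∩ {a, b, c, d}).Nonempty) := by
        intro t ht
        obtain ⟨j, hj, hX, hjt⟩ := L.mainA' hB hS hf (resA2 n m hg) (by
          simp only [List.forall_mem_cons, FE, E_vals, image_insert, image_singleton]
          exact ⟨⟨by omega, hx⟩, ⟨by omega, hy⟩, by simp⟩) t ht
        have hsem : E j ⊆ {1, 2, 3, 4} ∨ (0 ∈ E j ∧ ∃ v ∈ E j, v ∈ ({1, 2, 3, 4} : Finset ℕ)) := by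
          rcases hg with ⟨rfl, rfl⟩ | ⟨rfl, rfl⟩
          · exact xSK_sem84 j hj hX
          · exact xSK_sem120 j hj hX
        rcases hsem with hE | ⟨h0, w, hw, hw'⟩
        · apply mem_union_left
          refine mem_powersetCard.2 ⟨?_, (hH t ht).2⟩
          rw [← hjt]
          intro w hw
          obtain ⟨k, hk, rfl⟩ := mem_image.1 hw
          have hk' := hE hk
          simp only [mem_insert, mem_singleton] at hk'
          rcases hk' with rfl | rfl | rfl | rfl <;> simp
        · apply mem_union_right
          refine mem_filter.2 ⟨mem_powersetCard.2 (hH t ht), ?_, ?_⟩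
          · rw [← hjt]; exact mem_image_of_mem _ h0
          · refine ⟨_, mem_inter.2 ⟨by rw [← hjt]; exact mem_image_of_mem _ hw, ?_⟩⟩
            simp only [mem_insert, mem_singleton] at hw'
            rcases hw' with rfl | rfl | rfl | rfl <;> simp
      have hcard := card_SK hn hV v hv _ hAV hA4 hvA
      have heq := eq_of_subset_of_card_le hsub (by rw [hcard]; exact hB)
      exact ⟨⟨v, hv, _, hAV, hA4, hvA, heq⟩, by rw [← hcard, ← heq]⟩

end lemA

/-- For `n ∈ {9, 10}`: every `𝒫₄`-free 3-graph `H` on `n` vertices that is a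
sub-3-graph of neither the starplus `Sₙ⁺¹` nor `SPₙ` satisfies
`|H| ≤ 4n - 10`, with equality iff `H` is isomorphic to `SKₙ`. -/
theorem third_order_turan_small (n : ℕ) (hn : n = 9 ∨ n = 10)
    (V : Finset ℕ) (H : Finset (Finset ℕ)) (hV : V.card = n)
    (hH : ThreeGraphOn V H) (hfree : P4Free H)
    (hns : ¬SubStarPlus V H) (hnsp : ¬SubSP V H) :
    H.card ≤ 4 * n - 10 ∧ (H.card = 4 * n - 10 ↔ IsSKOn V H) := by
  obtain ⟨m, hg⟩ : ∃ m, GoodNM n m := by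
    rcases hn with h | h
    · exact ⟨84, Or.inl ⟨h, rfl⟩⟩
    · exact ⟨120, Or.inr ⟨h, rfl⟩⟩
  have key : 4 * n - 10 ≤ H.card → IsSKOn V H ∧ H.card = 4 * n - 10 := by
    intro hB
    have hnb := not_big hg hV hH hfree
    rw [Big, not_and] at hnb
    have := hnb hB
    push Not at this
    obtain ⟨v, hv, hv5⟩ := this
    rcases lemA hg hn hV hH hfree hB v hv (by omega) with h | h | h
    · exact absurd h hns
    · exact absurd h hnsp
    · exact h
  refine ⟨?_, fun h => (key h.ge).1, ?_⟩
  · rcases le_total (4 * n - 10) H.card with h | h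
    · exact (key h).2.le
    · exact h
  · rintro ⟨v, hv, A, hA, hA4, hvA, rfl⟩
    exact card_SK hn hV v hv A hA hA4 hvA
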